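/- arXiv:1811.08402 — 3 statements merged into one kernel-verified Lean document; each statement's English description precedes it below -/
import Mathlib

section
/- Let R be a Cohen-Macaulay local ring with infinite residue field, and let E be a finitely generated torsion-free R-module of rank e > 0 and analytic spread ℓ, with projective dimension 1, satisfying condition G_{ℓ−e+2}. Then E has no proper reductions (so μ(E) = ℓ), E satisfies G_∞, and Ext_R^{j+1}(E^j, R) = 0 for all j ≥ 1. -/
open scoped TensorProduct

noncomputable section

universe u

section Defs
variable (R : Type u) [CommRing R]

/-- The total ring of fractions of `R`. -/
abbrev TotalQuot := Localization (nonZeroDivisors R)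

/-- `E` has rank `e`: `E ⊗_R Quot(R)` is free of rank `e` over the total quotient ring. -/
def HasRank (E : Type u) [AddCommGroup E] [Module R E] (e : ℕ) : Prop :=
  Nonempty ((TotalQuot R ⊗[R] E) ≃ₗ[TotalQuot R] (Fin e → TotalQuot R))

/-- Complement of a prime ideal, with the primality hypothesis explicit. -/
def primeCompl' (p : Ideal R) (hp : p.IsPrime) : Submonoid R :=
  @Ideal.primeCompl R _ p hp

/-- Minimal number of generators of a module. -/
def minGens (E : Type u) [AddCommGroup E] [Module R E] : ℕ :=
  sInf {n | ∃ f : Fin n → E, Submodule.span R (Set.range f) = ⊤}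

/-- The grade of an ideal `I` on a module `M`: supremum of lengths of
`M`-regular sequences contained in `I`. -/
def sequenceGrade (I : Ideal R) (M : Type u) [AddCommGroup M] [Module R M] : ℕ∞ :=
  sSup {n : ℕ∞ | ∃ rs : List R, (rs.length : ℕ∞) = n ∧ (∀ r ∈ rs, r ∈ I) ∧
    RingTheory.Sequence.IsRegular M rs}

/-- Depth of a module over a local ring. -/
def moduleDepth [IsLocalRing R] (M : Type u) [AddCommGroup M] [Module R M] : ℕ∞ :=
  sequenceGrade R (IsLocalRing.maximalIdeal R) M

/-- The grade of a module: grade of its annihilator on `R`. -/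
def moduleGrade (M : Type u) [AddCommGroup M] [Module R M] : ℕ∞ :=
  sequenceGrade R (Module.annihilator R M) R

/-- Dimension of a module: Krull dimension of `R` modulo the annihilator. -/
def moduleDim (M : Type u) [AddCommGroup M] [Module R M] : WithBot ℕ∞ :=
  ringKrullDim (R ⧸ Module.annihilator R M)

/-- Krull dimension of the localization `R_p`. -/
def localDimAt (p : Ideal R) (hp : p.IsPrime) : WithBot ℕ∞ :=
  ringKrullDim (Localization (primeCompl' R p hp))

/-- Height of an ideal: infimum of `dim R_p` over primes `p ⊇ I`. -/
def idealHeight (I : Ideal R) : WithBot ℕ∞ :=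
  sInf {d | ∃ (p : Ideal R) (hp : p.IsPrime), I ≤ p ∧ d = localDimAt R p hp}

/-- A local ring is Cohen-Macaulay if its depth equals its dimension. -/
def IsCMLocalRing [IsLocalRing R] : Prop :=
  (moduleDepth R R : WithBot ℕ∞) = ringKrullDim R

/-- A ring is Cohen-Macaulay if all its localizations at maximal ideals are. -/
def IsCMRing : Prop :=
  ∀ (p : Ideal R), ∀ hp : p.IsMaximal,
    letI : p.IsPrime := hp.isPrime
    (moduleDepth (Localization.AtPrime p) (Localization.AtPrime p) : WithBot ℕ∞)
      = ringKrullDim (Localization.AtPrime p)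

/-- A finite module over a local ring is Cohen-Macaulay if it is zero or
its depth equals its dimension. -/
def IsCMModule [IsLocalRing R] (M : Type u) [AddCommGroup M] [Module R M] : Prop :=
  Subsingleton M ∨ (moduleDepth R M : WithBot ℕ∞) = moduleDim R M

open CategoryTheory in
/-- Vanishing of `Ext_R^n(M, N)`. -/
def extVanish (M N : Type u) [AddCommGroup M] [Module R M] [AddCommGroup N] [Module R N]
    (n : ℕ) : Prop :=
  Subsingleton (((Ext R (ModuleCat.{u} R) n).obj (Opposite.op (ModuleCat.of R M))).obj
    (ModuleCat.of R N))

/-- A Noetherian local ring is Gorenstein iff it is Cohen-Macaulay and `R` has finite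
injective dimension, i.e. `Ext^i(k, R) = 0` for all large `i`. -/
def IsGorensteinLocalRing [IsLocalRing R] : Prop :=
  IsCMLocalRing R ∧ ∃ n : ℕ, ∀ i : ℕ, n < i → extVanish R (IsLocalRing.ResidueField R) R i

variable (E : Type u) [AddCommGroup E] [Module R E]

/-- Defining relations of the symmetric algebra, presented as the free commutative
`R`-algebra on `E` modulo linearity relations. -/
def symRels : Set (MvPolynomial E R) :=
  {p | ∃ x y : E, p = MvPolynomial.X (x + y) - MvPolynomial.X x - MvPolynomial.X y} ∪
  {p | ∃ (r : R) (x : E), p = MvPolynomial.X (r • x) - MvPolynomial.C r * MvPolynomial.X x}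

/-- The symmetric algebra of a module. -/
abbrev SymModAlg := MvPolynomial E R ⧸ Ideal.span (symRels R E)

/-- The `R`-torsion ideal of an `R`-algebra `A`. -/
def torsionIdeal (A : Type u) [CommRing A] [Algebra R A] : Ideal A where
  carrier := {a | ∃ r ∈ nonZeroDivisors R, r • a = 0}
  zero_mem' := ⟨1, one_mem _, smul_zero _⟩
  add_mem' := by
    rintro a b ⟨r, hr, ha⟩ ⟨s, hs, hb⟩
    refine ⟨r * s, mul_mem hr hs, ?_⟩
    have h1 : (r * s) • a = 0 := by rw [mul_comm, mul_smul, ha, smul_zero]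
    have h2 : (r * s) • b = 0 := by rw [mul_smul, hb, smul_zero]
    rw [smul_add, h1, h2, add_zero]
  smul_mem' := by
    rintro c a ⟨r, hr, ha⟩
    exact ⟨r, hr, by rw [smul_comm, ha, smul_zero]⟩

/-- The Rees algebra of a module: the symmetric algebra modulo `R`-torsion. -/
abbrev ReesModAlg := SymModAlg R E ⧸ torsionIdeal R (SymModAlg R E)

/-- The canonical map `E → R(E)`. -/
def reesι (x : E) : ReesModAlg R E :=
  Ideal.Quotient.mk _ (Ideal.Quotient.mk _ (MvPolynomial.X x))

/-- The `j`-th power `E^j` of a module: the `j`-th graded component of its Rees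
algebra, i.e. the `R`-span of products of `j` elements of `E`. -/
def reesPower (j : ℕ) : Submodule R (ReesModAlg R E) :=
  Submodule.span R {a | ∃ f : Fin j → E, a = ∏ i, reesι R E (f i)}

/-- A module is of linear type if its symmetric algebra is `R`-torsion-free,
i.e. the natural surjection `S(E) → R(E)` is an isomorphism. -/
def IsLinearType : Prop := torsionIdeal R (SymModAlg R E) = ⊥

/-- The extension of the maximal ideal to the Rees algebra. -/
def fiberIdeal [IsLocalRing R] : Ideal (ReesModAlg R E) :=
  Ideal.map (algebraMap R (ReesModAlg R E)) (IsLocalRing.maximalIdeal R)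

/-- The analytic spread: Krull dimension of the special fiber ring `R(E) ⊗ k`. -/
def analyticSpread [IsLocalRing R] : WithBot ℕ∞ :=
  ringKrullDim (ReesModAlg R E ⧸ fiberIdeal R E)

/-- The submodule `U·E^r` of the Rees algebra. -/
def mulPower (U : Submodule R E) (r : ℕ) : Submodule R (ReesModAlg R E) :=
  Submodule.span R {a | ∃ u ∈ U, ∃ f : Fin r → E, a = reesι R E u * ∏ i, reesι R E (f i)}

/-- `U` is a reduction of `E` if `E^{r+1} = U·E^r` for some `r`. -/
def IsReduction (U : Submodule R E) : Prop :=
  ∃ r : ℕ, reesPower R E (r + 1) = mulPower R E U r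

/-- A minimal reduction. -/
def IsMinimalReduction (U : Submodule R E) : Prop :=
  IsReduction R E U ∧ ∀ U' : Submodule R E, U' ≤ U → IsReduction R E U' → U' = U

/-- The reduction number of a reduction `U`. -/
def reductionNumberOf (U : Submodule R E) : ℕ :=
  sInf {r | reesPower R E (r + 1) = mulPower R E U r}

/-- The reduction number of `E`. -/
def reductionNumber : ℕ :=
  sInf {r | ∃ U : Submodule R E, IsMinimalReduction R E U ∧ reductionNumberOf R E U = r}

/-- The condition `G_s` for a module of rank `e`:
`μ(E_p) ≤ dim R_p + e - 1` for all primes with `1 ≤ dim R_p ≤ s - 1`. -/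
def Gcond (e s : ℕ) : Prop :=
  ∀ (p : Ideal R) (hp : p.IsPrime),
    (1 : WithBot ℕ∞) ≤ localDimAt R p hp → localDimAt R p hp + 1 ≤ (s : WithBot ℕ∞) →
    (minGens (Localization (primeCompl' R p hp)) (LocalizedModule (primeCompl' R p hp) E)
        : WithBot ℕ∞) ≤ localDimAt R p hp + ((e - 1 : ℕ) : WithBot ℕ∞)

/-- The condition `G_∞` for a module of rank `e`. -/
def GcondInf (e : ℕ) : Prop := ∀ s : ℕ, Gcond R E e s

/-- The condition `G_s` for an ideal: `μ(I_p) ≤ dim R_p` for all primes `p ⊇ I`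
with `dim R_p ≤ s - 1`. -/
def GcondIdeal (I : Ideal R) (s : ℕ) : Prop :=
  ∀ (p : Ideal R) (hp : p.IsPrime), I ≤ p → localDimAt R p hp + 1 ≤ (s : WithBot ℕ∞) →
    (minGens (Localization (primeCompl' R p hp)) (LocalizedModule (primeCompl' R p hp) ↥I)
        : WithBot ℕ∞) ≤ localDimAt R p hp

/-- The `0`-th Fitting ideal of a module. -/
def fitting0 (M : Type u) [AddCommGroup M] [Module R M] : Ideal R :=
  ⨆ (n : ℕ) (π : (Fin n → R) →ₗ[R] M) (_ : Function.Surjective π),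
    Ideal.span {d | ∃ A : Matrix (Fin n) (Fin n) R,
      (∀ jc : Fin n, π (fun i => A i jc) = 0) ∧ d = A.det}

end Defs

section
open RingTheory.Sequence CategoryTheory Abelian Pointwise


/-- Weakly regular sequence of length `k` on `M` annihilating `N`: vanishing of Ext. -/
theorem aux_ext_vanish {R : Type u} [CommRing R] (N : ModuleCat.{u} R) (rs : List R)
    (hann : ∀ r ∈ rs, r ∈ Module.annihilator R N) :
    ∀ (M : ModuleCat.{u} R), IsWeaklyRegular M rs → ∀ i < rs.length, Subsingleton (Abelian.Ext N M i) := by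
  induction rs with
  | nil => simp
  | cons a rs ih =>
    intro M reg i hi
    have ha := hann a List.mem_cons_self
    have hann' : ∀ r ∈ rs, r ∈ Module.annihilator R N := fun r hr => hann r (List.mem_cons_of_mem _ hr)
    rw [isWeaklyRegular_cons_iff] at reg
    match i with
    | 0 =>
      have : Subsingleton (N →ₗ[R] M) := by
        refine ⟨fun f g => ?_⟩
        ext x
        apply reg.1
        have h1 : a • x = 0 := Module.mem_annihilator.mp ha x
        change a • f x = a • g x
        rw [← map_smul, ← map_smul, h1, map_zero, map_zero]
      exact (Ext.addEquiv₀.trans ModuleCat.homAddEquiv).subsingleton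
    | i + 1 =>
      let g := (AddCommGrpCat.ofHom ((Ext.mk₀ (ModuleCat.smulShortComplex M a).f).postcomp N
          (add_zero (i + 1))))
      have mono_g : Mono g := by
        apply (Ext.covariant_sequence_exact₁' N reg.1.smulShortComplex_shortExact i (i + 1)
            rfl).mono_g ((AddCommGrpCat.isZero_of_iff_subsingleton.mpr ?_).eq_zero_of_src _)
        exact ih hann' (ModuleCat.of R (QuotSMulTop a M)) reg.2 i (by simpa using hi)
      have zero_g : g = 0 := Ext.postcomp_smul_id_eq_zero_of_mem_annihilator ha (i + 1)
      exact AddCommGrpCat.subsingleton_of_isZero (Limits.IsZero.of_mono_eq_zero _ zero_g)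

/-- depth drops by at most one. -/
theorem aux_depth_quot {R : Type u} [CommRing R] [IsLocalRing R] [IsNoetherianRing R]
    (M : Type u) [AddCommGroup M] [Module R M] [Module.Finite R M] [Nontrivial M]
    (rs : List R) (d : ℕ) (hd : rs.length = d + 1) (hm : ∀ r ∈ rs, r ∈ IsLocalRing.maximalIdeal R)
    (reg : IsRegular M rs) (x : R) (hx : x ∈ IsLocalRing.maximalIdeal R) (hreg : IsSMulRegular M x) :
    ∃ rs' : List R, rs'.length = d ∧ (∀ r ∈ rs', r ∈ IsLocalRing.maximalIdeal R) ∧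
      IsRegular (QuotSMulTop x M) rs' := by
  set k := ModuleCat.of R (R ⧸ IsLocalRing.maximalIdeal R) with hk
  have hv := aux_ext_vanish k rs (by
    intro r hr
    rw [hk]; change r ∈ Module.annihilator R (R ⧸ IsLocalRing.maximalIdeal R)
    rw [Ideal.annihilator_quotient]; exact hm r hr) (ModuleCat.of R M) reg.toIsWeaklyRegular
  have : Nontrivial (QuotSMulTop x M) := nontrivial_quotSMulTop_of_mem_maximalIdeal M hx
  have hfin : Module.Finite R k := inferInstanceAs (Module.Finite R (R ⧸ IsLocalRing.maximalIdeal R))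
  refine ModuleCat.exists_isRegular_of_exists_subsingleton_ext (IsLocalRing.maximalIdeal R) d
    (ModuleCat.of R (QuotSMulTop x M)) ?_ k ?_ ?_
  · refine lt_top_iff_ne_top.mpr (fun h => ?_)
    have := Submodule.eq_bot_of_le_smul_of_le_jacobson_bot (IsLocalRing.maximalIdeal R) 
      (⊤ : Submodule R (QuotSMulTop x M)) Module.Finite.fg_top h.ge (IsLocalRing.maximalIdeal_le_jacobson _)
    exact top_ne_bot this
  · change Module.support R (R ⧸ IsLocalRing.maximalIdeal R) = _
    rw [Module.support_eq_zeroLocus, Ideal.annihilator_quotient]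
  · intro i hi
    have zero1 := AddCommGrpCat.isZero_of_iff_subsingleton.mpr (hv i (by omega))
    have zero2 := AddCommGrpCat.isZero_of_iff_subsingleton.mpr (hv (i + 1) (by omega))
    have hreg' : IsSMulRegular (ModuleCat.of R M) x := hreg
    exact AddCommGrpCat.subsingleton_of_isZero <| ShortComplex.Exact.isZero_of_both_zeros
        ((Ext.covariant_sequence_exact₃' k hreg'.smulShortComplex_shortExact) i (i + 1) rfl)
        (zero1.eq_zero_of_src _) (zero2.eq_zero_of_tgt _)

theorem aux_ass_step {R : Type u} [CommRing R] [IsLocalRing R] [IsNoetherianRing R]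
    (M : Type u) [AddCommGroup M] [Module R M] [Module.Finite R M] (P : Ideal R)
    (hP : P ∈ associatedPrimes R M) (x : R) (hx : x ∈ IsLocalRing.maximalIdeal R)
    (hreg : IsSMulRegular M x) : ∃ P' ∈ associatedPrimes R (QuotSMulTop x M), P < P' := by
  obtain ⟨hPp, m, hm⟩ := isAssociatedPrime_iff.mp hP
  have hmem : ∀ r, r ∈ P ↔ r • m = 0 := by
    intro r; rw [hm, Submodule.mem_colon_singleton, Submodule.mem_bot]
  have hm0 : m ≠ 0 := by
    rintro rfl
    exact hPp.ne_top ((Ideal.eq_top_iff_one _).mpr ((hmem 1).mpr (by simp)))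
  have hxP : x ∉ P := by
    intro h
    exact hm0 ((isSMulRegular_iff_right_eq_zero_of_smul.mp hreg) m ((hmem x).mp h))
  let L : Submodule R M :=
    { carrier := {w | ∀ r ∈ P, r • w = 0}
      zero_mem' := fun r _ => smul_zero r
      add_mem' := fun {a b} ha hb r hr => by rw [smul_add, ha r hr, hb r hr, add_zero]
      smul_mem' := fun c w hw r hr => by rw [smul_comm, hw r hr, smul_zero] }
  have hmL : m ∈ L := fun r hr => (hmem r).mp hr
  obtain ⟨w, hwL, hw⟩ : ∃ w ∈ L, w ∉ (x • (⊤ : Submodule R M)) := by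
    by_contra hcon
    push Not at hcon
    have hle : L ≤ IsLocalRing.maximalIdeal R • L := by
      intro w hw
      obtain ⟨y, -, hy⟩ := (Submodule.mem_smul_pointwise_iff_exists _ _ _).mp (hcon w hw)
      rw [← hy]
      refine Submodule.smul_mem_smul hx ?_
      intro r hr
      refine isSMulRegular_iff_right_eq_zero_of_smul.mp hreg _ ?_
      rw [smul_comm, hy, hw r hr]
    have hbot := Submodule.eq_bot_of_le_smul_of_le_jacobson_bot _ L (IsNoetherian.noetherian L) hle
      (IsLocalRing.maximalIdeal_le_jacobson _)
    rw [hbot] at hmL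
    exact hm0 (by simpa using hmL)
  let wb : QuotSMulTop x M := Submodule.Quotient.mk w
  have hwb : wb ≠ 0 := by
    intro h
    exact hw ((Submodule.Quotient.mk_eq_zero _).mp h)
  obtain ⟨P', hP', hle⟩ := exists_le_isAssociatedPrime_of_isNoetherianRing R wb hwb
  refine ⟨P', hP', lt_of_le_of_ne ?_ ?_⟩
  · intro r hr
    refine hle ?_
    rw [Submodule.mem_colon_singleton, Submodule.mem_bot]
    change Submodule.Quotient.mk (r • w) = _
    rw [hwL r hr, Submodule.Quotient.mk_zero]
  · rintro rfl
    refine hxP (hle ?_)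
    rw [Submodule.mem_colon_singleton, Submodule.mem_bot]
    change Submodule.Quotient.mk (x • w) = _
    rw [Submodule.Quotient.mk_eq_zero]
    exact Submodule.smul_mem_pointwise_smul _ _ _ trivial

theorem aux_ass_height {R : Type u} [CommRing R] [IsLocalRing R] [IsNoetherianRing R]
    (rs : List R) (hm : ∀ r ∈ rs, r ∈ IsLocalRing.maximalIdeal R) : 
    ∀ (M : Type u) [AddCommGroup M] [Module R M] [Module.Finite R M], IsRegular M rs → 
    ∀ P ∈ associatedPrimes R M, P.height + rs.length ≤ (IsLocalRing.maximalIdeal R).height := by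
  induction rs with
  | nil =>
    intro M _ _ _ _ P hP
    have := hP.isPrime
    simpa using Ideal.height_mono (IsLocalRing.le_maximalIdeal this.ne_top)
  | cons a rs ih =>
    intro M _ _ _ reg P hP
    rw [isRegular_cons_iff] at reg
    obtain ⟨P', hP', hlt⟩ := aux_ass_step M P hP a (hm a List.mem_cons_self) reg.1
    have h1 := ih (fun r hr => hm r (List.mem_cons_of_mem _ hr)) (QuotSMulTop a M) reg.2 P' hP'
    have := hP.isPrime
    have := hP'.isPrime
    have h2 := Ideal.height_add_one_le_of_lt_of_isPrime hlt
    refine le_trans ?_ h1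
    rw [List.length_cons]; push_cast
    calc P.height + (rs.length + 1) = P.height + 1 + rs.length := by ring
      _ ≤ _ := by gcongr

theorem aux_exists_regular {R : Type u} [CommRing R] [IsLocalRing R] [IsNoetherianRing R]
    (q : Ideal R) [q.IsPrime] (k : ℕ) : ∀ (c d : ℕ)
    (M : Type u) [AddCommGroup M] [Module R M] [Module.Finite R M] [Nontrivial M]
    (rs : List R) (_ : rs.length = d) (_ : ∀ r ∈ rs, r ∈ IsLocalRing.maximalIdeal R)
    (_ : IsRegular M rs) (_ : (IsLocalRing.maximalIdeal R).height ≤ d + c) 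
    (_ : ((k + c : ℕ) : ℕ∞) ≤ q.height),
    ∃ rs' : List R, rs'.length = k ∧ (∀ r ∈ rs', r ∈ q) ∧ IsWeaklyRegular M rs' := by
  have hqm : q ≤ IsLocalRing.maximalIdeal R := IsLocalRing.le_maximalIdeal Ideal.IsPrime.ne_top'
  induction k with
  | zero => intros; exact ⟨[], by simp⟩
  | succ k ih =>
    intro c d M _ _ _ _ rs hd hm reg hle hq
    have hex : ∃ x ∈ q, IsSMulRegular M x := by
      by_contra hcon
      push Not at hcon
      have hsub : (q : Set R) ⊆ ⋃ P ∈ associatedPrimes R M, (P : Set R) := by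
        intro x hx
        rw [biUnion_associatedPrimes_eq_zero_divisors]
        have := hcon x hx
        rw [isSMulRegular_iff_right_eq_zero_of_smul] at this
        push Not at this
        obtain ⟨m, h1, h2⟩ := this
        exact ⟨m, h2, h1⟩
      have := (Ideal.subset_union_prime_finite (associatedPrimes.finite R M) (f := id) ⊥ ⊥
        (fun P hP _ _ => AssociatedPrimes.mem_iff.mp hP |>.isPrime)).mp (by simpa using hsub)
      obtain ⟨P, hP, hqP⟩ := this
      have h1 := aux_ass_height rs hm M reg P hP
      have h2 : q.height ≤ P.height := Ideal.height_mono hqP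
      have h3 : ((k + 1 + c : ℕ) : ℕ∞) + d ≤ d + c := by
        rw [hd] at h1
        exact le_trans (by gcongr; exact hq.trans h2) (h1.trans hle)
      norm_cast at h3
      omega
    obtain ⟨x, hxq, hxr⟩ := hex
    obtain ⟨d, rfl⟩ : ∃ d', d = d' + 1 := by
      refine Nat.exists_eq_succ_of_ne_zero ?_
      rintro rfl
      have : ((k + 1 + c : ℕ) : ℕ∞) ≤ ((0:ℕ):ℕ∞) + c := hq.trans ((Ideal.height_mono hqm).trans hle)
      norm_cast at this
      omega
    have : Nontrivial (QuotSMulTop x M) := nontrivial_quotSMulTop_of_mem_maximalIdeal M (hqm hxq)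
    obtain ⟨rs1, h1, h2, h3⟩ := aux_depth_quot M rs d hd hm reg x (hqm hxq) hxr
    obtain ⟨rs2, g1, g2, g3⟩ := ih (c + 1) d (QuotSMulTop x M) rs1 h1 h2 h3 
      (by refine hle.trans (le_of_eq ?_); push_cast; ring) (by convert hq using 2; ring)
    exact ⟨x :: rs2, by simp [g1], by simpa [hxq] using g2, IsWeaklyRegular.cons hxr g3⟩

theorem aux_cm_regular {R : Type u} [CommRing R] [IsLocalRing R] [IsNoetherianRing R]
    (hCM : IsCMLocalRing R) (q : Ideal R) [q.IsPrime] (k : ℕ) (hk : (k : ℕ∞) ≤ q.height) :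
    ∃ rs' : List R, rs'.length = k ∧ (∀ r ∈ rs', r ∈ q) ∧ IsWeaklyRegular R rs' := by
  unfold IsCMLocalRing moduleDepth sequenceGrade at hCM
  rw [← IsLocalRing.maximalIdeal_height_eq_ringKrullDim] at hCM
  have hCM' := WithBot.coe_injective hCM
  have hfin : (IsLocalRing.maximalIdeal R).height ≠ ⊤ := Ideal.height_ne_top Ideal.IsPrime.ne_top'
  obtain ⟨d, hd⟩ := ENat.ne_top_iff_exists.mp hfin
  have hmem : (d : ℕ∞) ∈ {n : ℕ∞ | ∃ rs : List R, (rs.length : ℕ∞) = n ∧ 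
      (∀ r ∈ rs, r ∈ IsLocalRing.maximalIdeal R) ∧ IsRegular R rs} := by
    rw [hd, ← hCM']
    refine @ENat.sSup_mem_of_nonempty_of_lt_top _ (Set.nonempty_coe_sort.mpr ⟨0, [], by simp, by simp, 
      IsRegular.nil R R⟩) ?_
    rw [hCM', ← hd]; exact ENat.coe_lt_top d
  obtain ⟨rs, h1, h2, h3⟩ := hmem
  exact aux_exists_regular q k 0 d R rs (by exact_mod_cast h1) h2 h3 (by simp [hd]) (by simpa using hk)

end

section
open MvPolynomial

/-- linear form -/
def auxLf (A : Type u) [CommRing A] (n : ℕ) : (Fin n → A) →ₗ[A] MvPolynomial (Fin n) A :=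
  Fintype.linearCombination A (fun i => (X i : MvPolynomial (Fin n) A))

theorem auxLf_apply {A : Type u} [CommRing A] {n : ℕ} (w : Fin n → A) :
    auxLf A n w = ∑ i, C (w i) * X i := by
  simp [auxLf, Fintype.linearCombination_apply, MvPolynomial.smul_eq_C_mul]

theorem auxLf_single {A : Type u} [CommRing A] {n : ℕ} (i : Fin n) :
    auxLf A n (Pi.single i 1) = X i := by
  simp [auxLf, Fintype.linearCombination_apply_single]

def auxI (A : Type u) [CommRing A] {n m : ℕ} (v : Fin m → Fin n → A) (K : Finset (Fin m)) :
    Ideal (MvPolynomial (Fin n) A) :=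
  Ideal.span ((fun k => auxLf A n (v k)) '' (K : Set (Fin m)))

def auxPB (A : Type u) [CommRing A] {n m : ℕ} (v : Fin m → Fin n → A) (J : Finset (Fin m)) : Prop :=
  ∃ (ι : Type) (b : Module.Basis ι A (Fin n → A)) (σ : Fin m → ι),
    Set.InjOn σ J ∧ ∀ j ∈ J, b (σ j) = v j

theorem auxPB_mono {A : Type u} [CommRing A] {n m : ℕ} {v : Fin m → Fin n → A} {J K : Finset (Fin m)}
    (h : K ⊆ J) (hJ : auxPB A v J) : auxPB A v K := by
  obtain ⟨ι, b, σ, h1, h2⟩ := hJ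
  exact ⟨ι, b, σ, h1.mono (by exact_mod_cast h), fun j hj => h2 j (h hj)⟩

/-- polynomial ring in a new basis -/
theorem aux_basis_equiv {A : Type u} [CommRing A] {n : ℕ} {ι : Type} 
    (b : Module.Basis ι A (Fin n → A)) :
    ∃ Φ : MvPolynomial ι A ≃ₐ[A] MvPolynomial (Fin n) A, ∀ i, Φ (X i) = auxLf A n (b i) := by
  let L' : (Fin n → A) →ₗ[A] MvPolynomial ι A := b.constr A (fun i => (X i : MvPolynomial ι A))
  let Φ : MvPolynomial ι A →ₐ[A] MvPolynomial (Fin n) A := aeval (fun i => auxLf A n (b i))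
  let Ψ : MvPolynomial (Fin n) A →ₐ[A] MvPolynomial ι A := aeval (fun j => L' (Pi.single j 1))
  have h1 : Φ.toLinearMap ∘ₗ L' = auxLf A n := by
    refine b.ext fun i => ?_
    simp [L', Φ, Module.Basis.constr_basis]
  have h2 : Ψ.toLinearMap ∘ₗ auxLf A n = L' := by
    refine LinearMap.pi_ext' fun j => LinearMap.ext_ring ?_
    simp [auxLf_single, Ψ]
  refine ⟨AlgEquiv.ofAlgHom Φ Ψ ?_ ?_, fun i => ?_⟩
  · refine MvPolynomial.algHom_ext fun j => ?_
    have := LinearMap.congr_fun h1 (Pi.single j 1)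
    simpa [Ψ, auxLf_single] using this
  · refine MvPolynomial.algHom_ext fun i => ?_
    have := LinearMap.congr_fun h2 (b i)
    simpa [Φ, L', Module.Basis.constr_basis] using this
  · simp [Φ]

open Classical in
theorem aux_retract {A : Type u} [CommRing A] {n m : ℕ} {v : Fin m → Fin n → A} {J : Finset (Fin m)}
    (hJ : auxPB A v J) : ∃ κ : MvPolynomial (Fin n) A →ₐ[A] MvPolynomial (Fin n) A,
    (∀ f, f ∈ auxI A v J ↔ κ f = 0) ∧ ∀ f, f - κ f ∈ auxI A v J := by
  obtain ⟨ι, b, σ, h1, h2⟩ := hJ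
  obtain ⟨Φ, hΦ⟩ := aux_basis_equiv b
  let κ0 : MvPolynomial ι A →ₐ[A] MvPolynomial ι A :=
    aeval (fun i => if i ∈ σ '' (J : Set (Fin m)) then 0 else X i)
  let κ : MvPolynomial (Fin n) A →ₐ[A] MvPolynomial (Fin n) A :=
    (Φ.toAlgHom.comp κ0).comp Φ.symm.toAlgHom
  have hmk : ∀ f, f - κ f ∈ auxI A v J := by
    intro f
    have : (Ideal.Quotient.mkₐ A (auxI A v J)).comp Φ.toAlgHom = 
      ((Ideal.Quotient.mkₐ A (auxI A v J)).comp κ).comp Φ.toAlgHom := by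
      refine MvPolynomial.algHom_ext fun i => ?_
      by_cases hi : i ∈ σ '' (J : Set (Fin m))
      · obtain ⟨j, hj, rfl⟩ := hi
        have hmem : σ j ∈ σ '' (J : Set (Fin m)) := ⟨j, hj, rfl⟩
        have : Φ (X (σ j)) ∈ auxI A v J := by
          rw [hΦ, h2 j hj]; exact Ideal.subset_span ⟨j, hj, rfl⟩
        simp only [AlgHom.comp_apply, Ideal.Quotient.mkₐ_eq_mk, κ, κ0]
        simp only [AlgEquiv.toAlgHom_apply, AlgEquiv.symm_apply_apply, aeval_X, if_pos hmem, map_zero]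
        exact Ideal.Quotient.eq_zero_iff_mem.mpr this
      · simp only [AlgHom.comp_apply, Ideal.Quotient.mkₐ_eq_mk, κ, κ0]
        simp only [AlgEquiv.toAlgHom_apply, AlgEquiv.symm_apply_apply, aeval_X, if_neg hi]
    have h3 := AlgHom.congr_fun this (Φ.symm f)
    simp only [AlgHom.comp_apply, AlgEquiv.toAlgHom_apply, AlgEquiv.apply_symm_apply, 
      Ideal.Quotient.mkₐ_eq_mk] at h3
    exact (Ideal.Quotient.mk_eq_mk_iff_sub_mem _ _).mp h3
  refine ⟨κ, fun f => ⟨fun hf => ?_, fun hf => ?_⟩, hmk⟩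
  · have : auxI A v J ≤ RingHom.ker κ.toRingHom := by
      refine Ideal.span_le.mpr ?_
      rintro _ ⟨j, hj, rfl⟩
      have hmem : σ j ∈ σ '' (J : Set (Fin m)) := ⟨j, hj, rfl⟩
      change κ (auxLf A n (v j)) = 0
      rw [← h2 j hj, ← hΦ]
      simp only [AlgHom.comp_apply, κ, κ0, AlgEquiv.toAlgHom_apply, AlgEquiv.symm_apply_apply, aeval_X, 
        if_pos hmem, map_zero]
    exact this hf
  · have := hmk f
    rwa [hf, sub_zero] at this

open Classical in
theorem aux_regular {A : Type u} [CommRing A] {n m : ℕ} {v : Fin m → Fin n → A} {K : Finset (Fin m)}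
    {l : Fin m} (hl : l ∉ K) (hJ : auxPB A v (insert l K)) (z : MvPolynomial (Fin n) A)
    (hz : auxLf A n (v l) * z ∈ auxI A v K) : z ∈ auxI A v K := by
  obtain ⟨ι, b, σ, h1, h2⟩ := hJ
  obtain ⟨Φ, hΦ⟩ := aux_basis_equiv b
  -- transport to variables
  let IX : Ideal (MvPolynomial ι A) := Ideal.span ((fun i => (X i : MvPolynomial ι A)) '' (σ '' (K : Set (Fin m))))
  have hmap : ∀ f, f ∈ IX ↔ Φ f ∈ auxI A v K := by
    intro f
    have : auxI A v K = IX.map (Φ : MvPolynomial ι A →+* MvPolynomial (Fin n) A) := by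
      rw [Ideal.map_span, auxI, Set.image_image, Set.image_image]
      congr 1
      refine Set.image_congr fun j hj => ?_
      have := hΦ (σ j)
      rw [h2 j (Finset.mem_insert_of_mem hj)] at this
      exact this.symm
    rw [this]
    exact (Ideal.apply_mem_of_equiv_iff (f := Φ.toRingEquiv)).symm
  obtain ⟨y, rfl⟩ := Φ.surjective z
  have hll := hΦ (σ l)
  rw [h2 l (Finset.mem_insert_self _ _)] at hll
  rw [← hll, ← map_mul, ← hmap] at hz
  rw [← hmap]
  have hl' : σ l ∉ σ '' (K : Set (Fin m)) := by
    rintro ⟨j, hj, hjl⟩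
    have := h1 (by simp [Finset.mem_coe.mp hj]) (by simp) hjl
    exact hl (this ▸ hj)
  rw [mem_ideal_span_X_image] at hz ⊢
  intro mm hmm
  have : Finsupp.single (σ l) 1 + mm ∈ (X (σ l) * y).support := by
    rw [mem_support_iff, coeff_X_mul]
    exact mem_support_iff.mp hmm
  obtain ⟨i, hi, hne⟩ := hz _ this
  refine ⟨i, hi, ?_⟩
  have hne' : i ≠ σ l := by rintro rfl; exact hl' hi
  simpa [Finsupp.single_apply, hne'.symm] using hne

theorem aux_flat {A : Type u} [CommRing A] {n m : ℕ} {v : Fin m → Fin n → A} {J : Finset (Fin m)}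
    (hJ : auxPB A v J) : Module.Flat A (MvPolynomial (Fin n) A ⧸ auxI A v J) := by
  obtain ⟨κ, h1, h2⟩ := aux_retract hJ
  let i : (MvPolynomial (Fin n) A ⧸ auxI A v J) →ₗ[A] MvPolynomial (Fin n) A := 
    (Ideal.Quotient.liftₐ _ κ (fun a ha => (h1 a).mp ha)).toLinearMap
  let r : MvPolynomial (Fin n) A →ₗ[A] (MvPolynomial (Fin n) A ⧸ auxI A v J) :=
    (Ideal.Quotient.mkₐ A (auxI A v J)).toLinearMap
  have hri : r ∘ₗ i = LinearMap.id := by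
    refine LinearMap.ext fun x => ?_
    obtain ⟨f, rfl⟩ := Ideal.Quotient.mk_surjective x
    change Ideal.Quotient.mk _ (κ f) = Ideal.Quotient.mk _ f
    exact ((Ideal.Quotient.mk_eq_mk_iff_sub_mem _ _).mpr (h2 f)).symm
  have hfl : Module.Flat A (MvPolynomial (Fin n) A) := inferInstance
  exact Module.Flat.of_retract i r hri

/-! localization -/
theorem auxLf_map {A B : Type u} [CommRing A] [CommRing B] (f : A →+* B) {n : ℕ} (w : Fin n → A) :
    MvPolynomial.map f (auxLf A n w) = auxLf B n (fun i => f (w i)) := by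
  simp [auxLf_apply]

theorem auxI_map {A B : Type u} [CommRing A] [CommRing B] (f : A →+* B) {n m : ℕ} 
    (v : Fin m → Fin n → A) (K : Finset (Fin m)) :
    (auxI A v K).map (MvPolynomial.map f) = auxI B (fun j i => f (v j i)) K := by
  rw [auxI, Ideal.map_span, Set.image_image, auxI]
  congr 1
  refine Set.image_congr fun j _ => ?_
  exact auxLf_map f _

theorem aux_mem_loc {A B : Type u} [CommRing A] [CommRing B] [Algebra A B] (S : Submonoid A)
    [IsLocalization S B] {n m : ℕ} (v : Fin m → Fin n → A) (K : Finset (Fin m)) 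
    (g : MvPolynomial (Fin n) A) :
    MvPolynomial.map (algebraMap A B) g ∈ auxI B (fun j i => algebraMap A B (v j i)) K ↔
      ∃ s ∈ S, C s * g ∈ auxI A v K := by
  rw [← auxI_map]
  let _ : Algebra (MvPolynomial (Fin n) A) (MvPolynomial (Fin n) B) := algebraMvPolynomial
  have hloc : IsLocalization (S.map (C : A →+* MvPolynomial (Fin n) A)) (MvPolynomial (Fin n) B) :=
    MvPolynomial.isLocalization S B
  have := IsLocalization.algebraMap_mem_map_algebraMap_iff (S.map (C : A →+* MvPolynomial (Fin n) A))
    (MvPolynomial (Fin n) B) (auxI A v K) g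
  rw [MvPolynomial.algebraMap_def] at this
  rw [this]
  constructor
  · rintro ⟨_, ⟨s, hs, rfl⟩, h⟩
    exact ⟨s, hs, h⟩
  · rintro ⟨s, hs, h⟩
    exact ⟨_, ⟨s, hs, rfl⟩, h⟩

theorem aux_loc_surj {A B : Type u} [CommRing A] [CommRing B] [Algebra A B] (S : Submonoid A)
    [IsLocalization S B] {n : ℕ} (z : MvPolynomial (Fin n) B) :
    ∃ g : MvPolynomial (Fin n) A, ∃ s ∈ S, C (algebraMap A B s) * z = MvPolynomial.map (algebraMap A B) g := by
  let _ : Algebra (MvPolynomial (Fin n) A) (MvPolynomial (Fin n) B) := algebraMvPolynomial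
  have hloc : IsLocalization (S.map (C : A →+* MvPolynomial (Fin n) A)) (MvPolynomial (Fin n) B) :=
    MvPolynomial.isLocalization S B
  obtain ⟨⟨g, ⟨_, s, hs, rfl⟩⟩, h⟩ := IsLocalization.surj (S.map (C : A →+* MvPolynomial (Fin n) A)) z
  refine ⟨g, s, hs, ?_⟩
  rw [MvPolynomial.algebraMap_def] at h
  simpa [mul_comm] using h

end

section
open MvPolynomial
open RingTheory.Sequence CategoryTheory Abelian Pointwise

theorem auxI_insert {A : Type u} [CommRing A] {n m : ℕ} (v : Fin m → Fin n → A) (K : Finset (Fin m)) 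
    (l : Fin m) (f : MvPolynomial (Fin n) A) : f ∈ auxI A v (insert l K) ↔ 
      ∃ a, f - auxLf A n (v l) * a ∈ auxI A v K := by
  have : auxI A v (insert l K) = Ideal.span {auxLf A n (v l)} ⊔ auxI A v K := by
    rw [auxI, Finset.coe_insert, Set.image_insert_eq, Ideal.span_insert, auxI]
  rw [this, Submodule.mem_sup]
  constructor
  · rintro ⟨y, hy, z, hz, rfl⟩
    obtain ⟨a, rfl⟩ := Ideal.mem_span_singleton.mp hy
    exact ⟨a, by simpa using hz⟩
  · rintro ⟨a, ha⟩
    exact ⟨_, Ideal.mem_span_singleton.mpr ⟨a, rfl⟩, _, ha, by ring⟩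

theorem auxI_mono {A : Type u} [CommRing A] {n m : ℕ} (v : Fin m → Fin n → A) {K L : Finset (Fin m)} 
    (h : K ⊆ L) : auxI A v K ≤ auxI A v L :=
  Ideal.span_mono (Set.image_mono (by exact_mod_cast h))

/-- Short exact sequence of a mult map -/
theorem aux_ses (R : Type u) [CommRing R] {A : Type u} [CommRing A] [Algebra R A] {n m : ℕ} (v : Fin m → Fin n → A) 
    (K : Finset (Fin m)) (l : Fin m) 
    (hreg : ∀ z, auxLf A n (v l) * z ∈ auxI A v K → z ∈ auxI A v K) : 
    ∃ S : ShortComplex (ModuleCat.{u} R), S.ShortExact ∧ 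
      S.X₁ = ModuleCat.of R (MvPolynomial (Fin n) A ⧸ auxI A v K) ∧ 
      S.X₂ = ModuleCat.of R (MvPolynomial (Fin n) A ⧸ auxI A v K) ∧ 
      S.X₃ = ModuleCat.of R (MvPolynomial (Fin n) A ⧸ auxI A v (insert l K)) := by
  let f : (MvPolynomial (Fin n) A ⧸ auxI A v K) →ₗ[R] (MvPolynomial (Fin n) A ⧸ auxI A v K) :=
    LinearMap.mulLeft R (Ideal.Quotient.mk _ (auxLf A n (v l)))
  let g : (MvPolynomial (Fin n) A ⧸ auxI A v K) →ₗ[R] (MvPolynomial (Fin n) A ⧸ auxI A v (insert l K)) :=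
    (Ideal.Quotient.factorₐ R (auxI_mono v (Finset.subset_insert l K))).toLinearMap
  have hg : ∀ x, g (Ideal.Quotient.mk _ x) = Ideal.Quotient.mk _ x := fun x => rfl
  have hf : ∀ x, f (Ideal.Quotient.mk _ x) = Ideal.Quotient.mk _ (auxLf A n (v l) * x) := 
    fun x => rfl
  have hfg : g ∘ₗ f = 0 := by
    refine LinearMap.ext fun x => ?_
    obtain ⟨x, rfl⟩ := Ideal.Quotient.mk_surjective x
    rw [LinearMap.comp_apply, hf, hg, LinearMap.zero_apply, Ideal.Quotient.eq_zero_iff_mem]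
    exact (auxI_insert v K l _).mpr ⟨x, by simp⟩
  let S : ShortComplex (ModuleCat.{u} R) := ShortComplex.mk (ModuleCat.ofHom f) (ModuleCat.ofHom g)
    (by rw [← ModuleCat.ofHom_comp, hfg]; rfl)
  refine ⟨S, ?_, rfl, rfl, rfl⟩
  have hm : Mono S.f := by
    rw [ModuleCat.mono_iff_injective]
    change Function.Injective f
    rw [injective_iff_map_eq_zero]
    intro x hx
    obtain ⟨x, rfl⟩ := Ideal.Quotient.mk_surjective x
    rw [hf, Ideal.Quotient.eq_zero_iff_mem] at hx
    exact Ideal.Quotient.eq_zero_iff_mem.mpr (hreg x hx)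
  have he : Epi S.g := by
    rw [ModuleCat.epi_iff_surjective]
    change Function.Surjective g
    intro x
    obtain ⟨x, rfl⟩ := Ideal.Quotient.mk_surjective x
    exact ⟨_, hg x⟩
  refine ShortComplex.ShortExact.mk (S := S) ?_
  rw [ShortComplex.moduleCat_exact_iff]
  intro x hx
  change ∃ y, f y = x
  change g x = 0 at hx
  obtain ⟨x, rfl⟩ := Ideal.Quotient.mk_surjective x
  rw [hg, Ideal.Quotient.eq_zero_iff_mem, auxI_insert] at hx
  obtain ⟨a, ha⟩ := hx
  refine ⟨Ideal.Quotient.mk _ a, ?_⟩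
  rw [hf]
  exact ((Ideal.Quotient.mk_eq_mk_iff_sub_mem _ _).mpr ha).symm

theorem aux_flat_regular {R : Type u} [CommRing R] (M : Type u) [AddCommGroup M] [Module R M]
    [Module.Flat R M] (rs : List R) (h : IsWeaklyRegular R rs) : IsWeaklyRegular M rs := by
  have := h.isWeaklyRegular_lTensor (M₂ := M)
  exact (LinearEquiv.isWeaklyRegular_congr (TensorProduct.rid R M) rs).mp this

theorem aux_ext_M {R : Type u} [CommRing R] {B : Type u} [CommRing B] [Algebra R B] [Module.Flat R B] 
    (q : Ideal R) (rs : List R) (hrs : IsWeaklyRegular R rs) (hq : ∀ r ∈ rs, r ∈ q)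
    {n m : ℕ} (v : Fin m → Fin n → B) (J K : Finset (Fin m)) (hJ : auxPB B v J) 
    (hreg : ∀ L, J ⊆ L → L ⊆ K → ∀ l ∈ K, l ∉ L → 
      ∀ z, auxLf B n (v l) * z ∈ auxI B v L → z ∈ auxI B v L) (d : ℕ) :
    ∀ L, J ⊆ L → L ⊆ K → (L \ J).card = d → ∀ i, i + d < rs.length → 
    Subsingleton (Abelian.Ext (ModuleCat.of R (R ⧸ q)) 
      (ModuleCat.of R (MvPolynomial (Fin n) B ⧸ auxI B v L)) i) := by
  induction d with
  | zero =>
    intro L hJL hLK hd i hi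
    have : L = J := by
      refine Finset.Subset.antisymm ?_ hJL
      rw [← Finset.sdiff_eq_empty_iff_subset]; exact Finset.card_eq_zero.mp hd
    subst this
    have := aux_flat hJ
    have : Module.Flat R (MvPolynomial (Fin n) B ⧸ auxI B v L) := Module.Flat.trans R B _
    refine aux_ext_vanish _ rs ?_ _ (aux_flat_regular _ rs hrs) i hi
    intro r hr
    change r ∈ Module.annihilator R (R ⧸ q)
    rw [Ideal.annihilator_quotient]; exact hq r hr
  | succ d ih =>
    intro L hJL hLK hd i hi
    obtain ⟨l, hl⟩ : (L \ J).Nonempty := by rw [← Finset.card_pos]; omega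
    rw [Finset.mem_sdiff] at hl
    have hL : insert l (L.erase l) = L := Finset.insert_erase hl.1
    have hJL' : J ⊆ L.erase l := fun x hx => Finset.mem_erase.mpr ⟨by rintro rfl; exact hl.2 hx, hJL hx⟩
    have hLK' : L.erase l ⊆ K := (Finset.erase_subset _ _).trans hLK
    have hd' : ((L.erase l) \ J).card = d := by
      rw [Finset.erase_sdiff_comm, Finset.card_erase_of_mem (Finset.mem_sdiff.mpr hl), hd]; rfl
    obtain ⟨S, hS, h1, h2, h3⟩ := aux_ses R v (L.erase l) l 
      (hreg _ hJL' hLK' l (hLK hl.1) (Finset.notMem_erase _ _))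
    rw [hL] at h3
    rw [← h3]
    have e1 := ih _ hJL' hLK' hd' i (by omega)
    have e2 := ih _ hJL' hLK' hd' (i + 1) (by omega)
    rw [← h2] at e1
    rw [← h1] at e2
    exact AddCommGrpCat.subsingleton_of_isZero <| ShortComplex.Exact.isZero_of_both_zeros
        ((Ext.covariant_sequence_exact₃' (ModuleCat.of R (R ⧸ q)) hS) i (i + 1) rfl)
        ((AddCommGrpCat.isZero_of_iff_subsingleton.mpr e1).eq_zero_of_src _) 
        ((AddCommGrpCat.isZero_of_iff_subsingleton.mpr e2).eq_zero_of_tgt _)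

theorem aux_M_zero {R : Type u} [CommRing R] {B : Type u} [CommRing B] [Algebra R B] [Module.Flat R B] 
    (q : Ideal R) (rs : List R) (hrs : IsWeaklyRegular R rs) (hq : ∀ r ∈ rs, r ∈ q)
    {n m : ℕ} (v : Fin m → Fin n → B) (J K : Finset (Fin m)) (hJK : J ⊆ K) (hJ : auxPB B v J) 
    (hreg : ∀ L, J ⊆ L → L ⊆ K → ∀ l ∈ K, l ∉ L → 
      ∀ z, auxLf B n (v l) * z ∈ auxI B v L → z ∈ auxI B v L) (hc : (K \ J).card < rs.length) 
    (w : MvPolynomial (Fin n) B) (hw : ∀ r ∈ q, C (algebraMap R B r) * w ∈ auxI B v K) : 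
    w ∈ auxI B v K := by
  have := aux_ext_M q rs hrs hq v J K hJ hreg _ K hJK subset_rfl rfl 0 (by simpa using hc)
  have hs : Subsingleton ((R ⧸ q) →ₗ[R] (MvPolynomial (Fin n) B ⧸ auxI B v K)) :=
    ((Ext.addEquiv₀ (X := ModuleCat.of R (R ⧸ q)) 
      (Y := ModuleCat.of R (MvPolynomial (Fin n) B ⧸ auxI B v K))).trans ModuleCat.homAddEquiv).symm.subsingleton
  let f0 : R →ₗ[R] (MvPolynomial (Fin n) B ⧸ auxI B v K) := 
    LinearMap.toSpanSingleton R _ (Ideal.Quotient.mk _ w)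
  let f : (R ⧸ q) →ₗ[R] (MvPolynomial (Fin n) B ⧸ auxI B v K) :=
    Submodule.liftQ q f0 (by
      intro r hr
      rw [LinearMap.mem_ker, LinearMap.toSpanSingleton_apply]
      have := hw r hr
      rw [← Ideal.Quotient.eq_zero_iff_mem] at this
      rw [← this]
      change Ideal.Quotient.mk _ (r • w) = _
      rw [Algebra.smul_def]
      rfl)
  have h1 : f (Submodule.Quotient.mk 1) = 0 := by
    rw [Subsingleton.elim f 0]; rfl
  have h2 : f (Submodule.Quotient.mk 1) = Ideal.Quotient.mk _ w := by
    change f0 1 = _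
    simp [f0]
  rw [← Ideal.Quotient.eq_zero_iff_mem, ← h2, h1]

def auxHyp (R : Type u) [CommRing R] {n m : ℕ} (v : Fin m → Fin n → R) (q : Ideal R) [q.IsPrime] : Prop :=
  ∃ J : Finset (Fin m), ((Finset.univ \ J).card : ℕ∞) < q.height ∧ 
    auxPB (Localization.AtPrime q) (fun j i => algebraMap R (Localization.AtPrime q) (v j i)) J

theorem aux_generic_regular {R : Type u} [CommRing R] {n m : ℕ} (v : Fin m → Fin n → R)
    (hgen : auxPB (TotalQuot R) (fun j i => algebraMap R (TotalQuot R) (v j i)) Finset.univ)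
    (L : Finset (Fin m)) (l : Fin m) (hl : l ∉ L) (z : MvPolynomial (Fin n) R)
    (hz : auxLf R n (v l) * z ∈ auxI R v L) : ∃ c ∈ nonZeroDivisors R, C c * z ∈ auxI R v L := by
  rw [← aux_mem_loc (B := TotalQuot R) (nonZeroDivisors R) v L]
  refine aux_regular hl (auxPB_mono (Finset.subset_univ _) hgen) _ ?_
  have h1 := auxLf_map (algebraMap R (TotalQuot R)) (v l)
  rw [← h1, ← map_mul, aux_mem_loc (B := TotalQuot R) (nonZeroDivisors R) v L]
  exact ⟨1, one_mem _, by simpa using hz⟩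

theorem aux_T {R : Type u} [CommRing R] [IsLocalRing R] [IsNoetherianRing R]
    (hCM : IsCMLocalRing R) {n m : ℕ} (v : Fin m → Fin n → R)
    (hgen : auxPB (TotalQuot R) (fun j i => algebraMap R (TotalQuot R) (v j i)) Finset.univ)
    (K : Finset (Fin m)) : ∀ (p : Ideal R) [p.IsPrime]
    (_ : ∀ (q : Ideal R) [q.IsPrime], q ≤ p → (∃ a ∈ q, a ∈ nonZeroDivisors R) → auxHyp R v q)
    (z : MvPolynomial (Fin n) R) (a : R) (_ : a ∈ nonZeroDivisors R) (_ : C a * z ∈ auxI R v K),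
    ∃ s, s ∉ p ∧ C s * z ∈ auxI R v K := by
  induction K using Finset.strongInduction with
  | H K ih =>
  intro p _ hyp z a ha haz
  by_contra hcon
  push Not at hcon
  let 𝔞 : Ideal R := 
    { carrier := {r | C r * z ∈ auxI R v K}
      zero_mem' := by simp
      add_mem' := fun {a b} ha hb => by
        change C (a + b) * z ∈ auxI R v K
        rw [C_add, add_mul]; exact add_mem ha hb
      smul_mem' := fun c w hw => by
        change C (c * w) * z ∈ auxI R v K
        rw [C_mul, mul_assoc]; exact Ideal.mul_mem_left _ _ hw }
  have h𝔞 : ∀ r, r ∈ 𝔞 ↔ C r * z ∈ auxI R v K := fun r => Iff.rfl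
  have h𝔞p : 𝔞 ≤ p := by
    intro r hr
    by_contra hrp
    exact hcon r hrp ((h𝔞 r).mp hr)
  obtain ⟨q, hq, hqp⟩ := Ideal.exists_minimalPrimes_le h𝔞p
  have hqprime : q.IsPrime := hq.1.1
  have hqass : q ∈ associatedPrimes R (R ⧸ 𝔞) := by
    refine Module.associatedPrimes.minimalPrimes_annihilator_subset_associatedPrimes R (R ⧸ 𝔞) ?_
    rwa [Ideal.annihilator_quotient]
  obtain ⟨-, y, hy⟩ := isAssociatedPrime_iff.mp hqass
  obtain ⟨y, rfl⟩ := Ideal.Quotient.mk_surjective y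
  have hmem : ∀ r, r ∈ q ↔ C r * (C y * z) ∈ auxI R v K := by
    intro r
    rw [hy, Submodule.mem_colon_singleton, Submodule.mem_bot]
    change Ideal.Quotient.mk 𝔞 (r * y) = 0 ↔ _
    rw [Ideal.Quotient.eq_zero_iff_mem, h𝔞, C_mul, mul_assoc]
  obtain ⟨J, hJc, hJ⟩ := hyp q hqp ⟨a, hq.1.2 ((h𝔞 a).mpr haz), ha⟩
  have hfin : q.height ≠ ⊤ := Ideal.height_ne_top hqprime.ne_top
  obtain ⟨h, hh⟩ := ENat.ne_top_iff_exists.mp hfin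
  obtain ⟨rs, hr1, hr2, hr3⟩ := aux_cm_regular hCM q h (le_of_eq hh)
  rw [← hh] at hJc
  have hJc' : (Finset.univ \ J).card < h := by exact_mod_cast hJc
  have hyp' : ∀ (q' : Ideal R) [q'.IsPrime], q' ≤ q → (∃ a ∈ q', a ∈ nonZeroDivisors R) → auxHyp R v q' :=
    fun q' _ h1 h2 => hyp q' (h1.trans hqp) h2
  have key := aux_M_zero (B := Localization.AtPrime q) q rs hr3 hr2 
    (fun j i => algebraMap R (Localization.AtPrime q) (v j i)) (J ∩ K) K Finset.inter_subset_right 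
    (auxPB_mono Finset.inter_subset_left hJ) ?_ ?_ (MvPolynomial.map (algebraMap R _) (C y * z)) ?_
  · obtain ⟨s, hs, hsz⟩ := (aux_mem_loc (B := Localization.AtPrime q) q.primeCompl v K _).mp key
    exact hs ((hmem s).mpr hsz)
  · intro L _ hLK l hlK hlL z' hz'
    obtain ⟨g, s, hs, hg⟩ := aux_loc_surj (B := Localization.AtPrime q) q.primeCompl z'
    have hunit : IsUnit (C (σ := Fin n) (algebraMap R (Localization.AtPrime q) s)) := 
      (IsLocalization.map_units (Localization.AtPrime q) (⟨s, hs⟩ : q.primeCompl)).map C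
    rw [← Ideal.unit_mul_mem_iff_mem _ hunit, hg, aux_mem_loc q.primeCompl]
    have h1 : MvPolynomial.map (algebraMap R (Localization.AtPrime q)) (auxLf R n (v l) * g) ∈ 
        auxI (Localization.AtPrime q) (fun j i => algebraMap R (Localization.AtPrime q) (v j i)) L := by
      have h2 := auxLf_map (algebraMap R (Localization.AtPrime q)) (v l)
      rw [map_mul, h2, ← hg, mul_left_comm]
      exact Ideal.mul_mem_left _ _ hz'
    rw [aux_mem_loc q.primeCompl] at h1
    obtain ⟨s', hs', h3⟩ := h1
    rw [mul_left_comm] at h3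
    obtain ⟨c, hc, h4⟩ := aux_generic_regular v hgen L l hlL _ h3
    obtain ⟨s'', hs'', h5⟩ := ih L (Finset.ssubset_iff_subset_ne.mpr ⟨hLK, by rintro rfl; exact hlL hlK⟩) 
      q hyp' _ c hc h4
    refine ⟨s'' * s', q.primeCompl.mul_mem hs'' hs', ?_⟩
    rwa [C_mul, mul_assoc]
  · rw [hr1]
    refine lt_of_le_of_lt (Finset.card_le_card ?_) hJc'
    intro x hx
    simp only [Finset.mem_sdiff, Finset.mem_inter, Finset.mem_univ, true_and] at hx ⊢
    tauto
  · intro r hr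
    have h1 := (hmem r).mp hr
    have h2 : C (algebraMap R (Localization.AtPrime q) r) = MvPolynomial.map (σ := Fin n) (algebraMap R (Localization.AtPrime q)) (C r) := by simp
    rw [h2, ← map_mul, aux_mem_loc q.primeCompl]
    exact ⟨1, one_mem _, by simpa using h1⟩

end

section
open MvPolynomial TensorProduct

theorem aux_split_basis {A : Type u} [CommRing A] {n m e : ℕ} (f : (Fin m → A) →ₗ[A] (Fin n → A))
    (g : (Fin n → A) →ₗ[A] (Fin e → A)) (hf : Function.Injective f) (hg : Function.Surjective g)
    (hfg : Function.Exact f g) : ∃ b : Module.Basis (Fin m ⊕ Fin e) A (Fin n → A), 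
      ∀ j, b (Sum.inl j) = f (Pi.single j 1) := by
  obtain ⟨l, hl⟩ := Module.projective_lifting_property g LinearMap.id hg
  obtain ⟨E, hE, -⟩ := hfg.splitSurjectiveEquiv hf ⟨l, hl⟩
  refine ⟨((Pi.basisFun A (Fin m)).prod (Pi.basisFun A (Fin e))).map E.symm, fun j => ?_⟩
  rw [hE]
  simp

theorem aux_generic {R : Type u} [CommRing R] [Nontrivial R] {E : Type u} [AddCommGroup E] [Module R E] {n m e : ℕ}
    (hrank : HasRank R E e) (φ : (Fin m → R) →ₗ[R] (Fin n → R)) (ψ : (Fin n → R) →ₗ[R] E)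
    (hφ : Function.Injective φ) (hψ : Function.Surjective ψ) (hφψ : LinearMap.range φ = LinearMap.ker ψ) :
    n = m + e ∧ auxPB (TotalQuot R) (fun j i => algebraMap R (TotalQuot R) (φ (Pi.single j 1) i)) Finset.univ := by
  obtain ⟨ε⟩ := hrank
  let pn := TensorProduct.piScalarRight R (TotalQuot R) (TotalQuot R) (Fin n)
  let pm := TensorProduct.piScalarRight R (TotalQuot R) (TotalQuot R) (Fin m)
  let f : (Fin m → TotalQuot R) →ₗ[TotalQuot R] (Fin n → TotalQuot R) := 
    pn.toLinearMap ∘ₗ φ.baseChange (TotalQuot R) ∘ₗ pm.symm.toLinearMap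
  let g : (Fin n → TotalQuot R) →ₗ[TotalQuot R] (Fin e → TotalQuot R) := 
    ε.toLinearMap ∘ₗ ψ.baseChange (TotalQuot R) ∘ₗ pn.symm.toLinearMap
  have hfl : Module.Flat R (TotalQuot R) := IsLocalization.flat _ (nonZeroDivisors R)
  have hbφ : Function.Injective (φ.baseChange (TotalQuot R)) := 
    Module.Flat.lTensor_preserves_injective_linearMap (M := TotalQuot R) φ hφ
  have hbψ : Function.Surjective (ψ.baseChange (TotalQuot R)) := LinearMap.lTensor_surjective _ hψ
  have hex : Function.Exact (φ.baseChange (TotalQuot R)) (ψ.baseChange (TotalQuot R)) :=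
    lTensor_exact (TotalQuot R) (LinearMap.exact_iff.mpr hφψ.symm) hψ
  have hf : Function.Injective f := pn.injective.comp (hbφ.comp pm.symm.injective)
  have hg : Function.Surjective g := ε.surjective.comp (hbψ.comp pn.symm.surjective)
  have hfg : Function.Exact f g := by
    intro y
    constructor
    · intro hy
      have h1 : (ψ.baseChange (TotalQuot R)) (pn.symm y) = 0 := by
        apply ε.injective; rw [map_zero]; exact hy
      obtain ⟨x, hx⟩ := (hex _).mp h1
      refine ⟨pm x, ?_⟩
      simp [f, hx]
    · rintro ⟨x, rfl⟩
      have := (hex (φ.baseChange (TotalQuot R) (pm.symm x))).mpr ⟨_, rfl⟩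
      simp [f, g, this]
  obtain ⟨b, hb⟩ := aux_split_basis f g hf hg hfg
  have hfv : ∀ j, f (Pi.single j 1) = fun i => algebraMap R (TotalQuot R) (φ (Pi.single j 1) i) := by
    intro j
    have h1 : pm.symm (Pi.single j 1) = 1 ⊗ₜ[R] (Pi.single j 1) := by
      rw [LinearEquiv.symm_apply_eq]
      ext i
      simp [pm, Pi.single_apply]
    ext i
    simp only [f, LinearMap.comp_apply, LinearEquiv.coe_coe, h1, LinearMap.baseChange_tmul]
    simp [pn, Algebra.smul_def]
  constructor
  · have := Module.finrank_eq_card_basis b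
    simpa using this
  · refine ⟨_, b, Sum.inl, Sum.inl_injective.injOn, fun j _ => ?_⟩
    rw [hb, hfv]

theorem aux_lift_basis {A : Type u} [CommRing A] [IsLocalRing A] {n : ℕ} (b : Fin n → Fin n → A)
    (bb : Module.Basis (Fin n) (IsLocalRing.ResidueField A) (Fin n → IsLocalRing.ResidueField A))
    (h : ∀ i j, bb i j = IsLocalRing.residue A (b i j)) : 
    ∃ b' : Module.Basis (Fin n) A (Fin n → A), ∀ i, b' i = b i := by
  have h1 : IsUnit ((Pi.basisFun A (Fin n)).det b) := by
    have h2 := ((Pi.basisFun (IsLocalRing.ResidueField A) (Fin n)).is_basis_iff_det (v := bb)).mp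
      ⟨bb.linearIndependent, bb.span_eq⟩
    rw [Module.Basis.det_apply] at h2 ⊢
    have h3 : (Pi.basisFun (IsLocalRing.ResidueField A) (Fin n)).toMatrix bb = 
      ((Pi.basisFun A (Fin n)).toMatrix b).map (IsLocalRing.residue A) := by
      ext i j
      simp [Module.Basis.toMatrix_apply, h]
    rw [h3] at h2
    have h4 := RingHom.map_det (IsLocalRing.residue A) ((Pi.basisFun A (Fin n)).toMatrix b)
    rw [RingHom.mapMatrix_apply] at h4
    rw [← h4] at h2
    exact isUnit_of_map_unit _ _ h2
  have h2 := ((Pi.basisFun A (Fin n)).is_basis_iff_det (v := b)).mpr h1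
  exact ⟨Module.Basis.mk h2.1 h2.2.ge, fun i => by simp⟩

open Classical in
/-- Choose a maximal residually independent set of columns -/
theorem aux_choose_J {A : Type u} [CommRing A] [IsLocalRing A] {n m : ℕ} (hn : 0 < n) (v : Fin m → Fin n → A) : 
    ∃ J : Finset (Fin m), auxPB A v J ∧ J.card = 
      Module.finrank (IsLocalRing.ResidueField A) (Submodule.span (IsLocalRing.ResidueField A) 
        (Set.range (fun j i => IsLocalRing.residue A (v j i)))) := by
  obtain ⟨κ, a, ha, hsp, hli⟩ := exists_linearIndependent' (IsLocalRing.ResidueField A) 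
    (fun j i => IsLocalRing.residue A (v j i))
  have : Fintype κ := Fintype.ofInjective a ha
  let bb0 := Module.Basis.sumExtend hli
  have : Finite (κ ⊕ (Module.Basis.sumExtendIndex hli)) := Module.Finite.finite_basis bb0
  have : Fintype (κ ⊕ (Module.Basis.sumExtendIndex hli)) := Fintype.ofFinite _
  have hcard : Fintype.card (κ ⊕ (Module.Basis.sumExtendIndex hli)) = n := by
    have := Module.finrank_eq_card_basis bb0
    simpa using this.symm
  let eqv := Fintype.equivFinOfCardEq hcard
  let bb := bb0.reindex eqv
  let σ : Fin m → Fin n := Function.extend a (fun k => eqv (Sum.inl k)) (fun _ => ⟨0, hn⟩)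
  have hσ : ∀ k, σ (a k) = eqv (Sum.inl k) := fun k => ha.extend_apply _ _ _
  have hbb : ∀ k, bb (eqv (Sum.inl k)) = fun i => IsLocalRing.residue A (v (a k) i) := by
    intro k
    simp only [bb, Module.Basis.reindex_apply, Equiv.symm_apply_apply, bb0, Module.Basis.sumExtend]
    simp
    rfl
  have hlift : ∀ i : Fin n, ∃ w : Fin n → A, (∀ j, bb i j = IsLocalRing.residue A (w j)) ∧ 
      ∀ k, eqv (Sum.inl k) = i → w = v (a k) := by
    intro i
    by_cases hi : ∃ k, eqv (Sum.inl k) = i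
    · obtain ⟨k, rfl⟩ := hi
      refine ⟨v (a k), fun j => by rw [hbb], fun k' hk' => ?_⟩
      have := Sum.inl_injective (eqv.injective hk')
      rw [this]
    · choose w hw using fun j => IsLocalRing.residue_surjective (R := A) (bb i j)
      exact ⟨w, fun j => (hw j).symm, fun k hk => absurd ⟨k, hk⟩ hi⟩
  choose w hw1 hw2 using hlift
  obtain ⟨b', hb'⟩ := aux_lift_basis w bb hw1
  refine ⟨Finset.univ.image a, ⟨Fin n, b', σ, ?_, ?_⟩, ?_⟩
  · intro x hx y hy hxy
    simp only [Finset.coe_image, Finset.coe_univ, Set.image_univ, Set.mem_range] at hx hy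
    obtain ⟨k, rfl⟩ := hx
    obtain ⟨k', rfl⟩ := hy
    rw [hσ, hσ] at hxy
    rw [Sum.inl_injective (eqv.injective hxy)]
  · intro j hj
    obtain ⟨k, -, rfl⟩ := Finset.mem_image.mp hj
    rw [hb', hσ]
    exact hw2 _ k rfl
  · rw [Finset.card_image_of_injective _ ha, Finset.card_univ, ← hsp]
    exact (finrank_span_eq_card hli).symm

/-- residue rank bounds number of generators of localization -/
theorem aux_rank_bound {R : Type u} [CommRing R] {E : Type u} [AddCommGroup E] [Module R E] {n m : ℕ}
    (φ : (Fin m → R) →ₗ[R] (Fin n → R)) (ψ : (Fin n → R) →ₗ[R] E)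
    (hψ : Function.Surjective ψ) (hφψ : LinearMap.range φ = LinearMap.ker ψ) (q : Ideal R) [q.IsPrime] 
    (N : ℕ) (w : Fin N → LocalizedModule q.primeCompl E) 
    (hw : Submodule.span (Localization.AtPrime q) (Set.range w) = ⊤) :
    n ≤ N + Module.finrank (IsLocalRing.ResidueField (Localization.AtPrime q)) 
      (Submodule.span (IsLocalRing.ResidueField (Localization.AtPrime q)) 
        (Set.range (fun j i => IsLocalRing.residue (Localization.AtPrime q) 
          (algebraMap R (Localization.AtPrime q) (φ (Pi.single j 1) i))))) := by
  set A := Localization.AtPrime q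
  set κ := IsLocalRing.ResidueField A
  set W := Submodule.span κ 
        (Set.range (fun j i => IsLocalRing.residue A (algebraMap R A (φ (Pi.single j 1) i)))) with hW
  let c : (Fin n → R) →ₗ[R] (Fin n → κ) := LinearMap.pi (fun i => (Algebra.linearMap R κ) ∘ₗ LinearMap.proj i)
  let π : (Fin n → κ) →ₗ[R] ((Fin n → κ) ⧸ W) := W.mkQ.restrictScalars R
  have hc : LinearMap.ker ψ ≤ LinearMap.ker (π ∘ₗ c) := by
    rw [← hφψ]
    rintro _ ⟨x, rfl⟩
    have : (π ∘ₗ c) ∘ₗ φ = 0 := by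
      refine LinearMap.pi_ext' fun j => LinearMap.ext_ring ?_
      change W.mkQ (c (φ (Pi.single j 1))) = 0
      rw [Submodule.mkQ_apply, Submodule.Quotient.mk_eq_zero]
      exact Submodule.subset_span ⟨j, rfl⟩
    exact LinearMap.congr_fun this x
  let g : E →ₗ[R] ((Fin n → κ) ⧸ W) := 
    (LinearMap.ker ψ).liftQ (π ∘ₗ c) hc ∘ₗ (ψ.quotKerEquivOfSurjective hψ).symm.toLinearMap
  have hg : ∀ x, g (ψ x) = π (c x) := by
    intro x
    have : (ψ.quotKerEquivOfSurjective hψ).symm (ψ x) = Submodule.Quotient.mk x := by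
      rw [LinearEquiv.symm_apply_eq]; rfl
    simp [g, this]
  have hunit : ∀ x : q.primeCompl, IsUnit ((algebraMap R (Module.End R ((Fin n → κ) ⧸ W))) (x : R)) := by
    intro x
    have h1 : IsUnit (algebraMap R A x) := IsLocalization.map_units A x
    have h2 := h1.map (algebraMap A (Module.End A ((Fin n → κ) ⧸ W)))
    rw [Module.End.isUnit_iff] at h2 ⊢
    convert h2 using 1
    ext y
    simp
  let G := IsLocalizedModule.lift q.primeCompl (LocalizedModule.mkLinearMap q.primeCompl E) g hunit
  let G' : LocalizedModule q.primeCompl E →ₗ[A] ((Fin n → κ) ⧸ W) := 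
    LinearMap.extendScalarsOfIsLocalization q.primeCompl A G
  have hG' : ∀ x, G' (LocalizedModule.mkLinearMap q.primeCompl E (ψ x)) = π (c x) := by
    intro x
    rw [← hg]
    exact IsLocalizedModule.lift_apply q.primeCompl (LocalizedModule.mkLinearMap q.primeCompl E) g hunit (ψ x)
  have hspan : Submodule.span κ (Set.range (G' ∘ w)) = ⊤ := by
    rw [eq_top_iff]
    have h1 : ∀ y, G' y ∈ Submodule.span κ (Set.range (G' ∘ w)) := by
      intro y
      have hy : y ∈ Submodule.span A (Set.range w) := by rw [hw]; trivial
      have h2 : G' y ∈ (Submodule.span A (Set.range w)).map G' := ⟨y, hy, rfl⟩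
      rw [Submodule.map_span, ← Set.range_comp] at h2
      exact Submodule.span_le_restrictScalars A κ _ h2
    have h3 : ∀ i : Fin n, W.mkQ (Pi.single i 1) ∈ Submodule.span κ (Set.range (G' ∘ w)) := by
      intro i
      have := h1 (LocalizedModule.mkLinearMap q.primeCompl E (ψ (Pi.single i 1)))
      rw [hG'] at this
      convert this using 1
      change _ = W.mkQ _
      congr 1
      ext j
      simp [c, Pi.single_apply]
    rintro y -
    obtain ⟨y, rfl⟩ := W.mkQ_surjective y
    rw [← (Pi.basisFun κ (Fin n)).sum_repr y, map_sum]
    refine Submodule.sum_mem _ fun i _ => ?_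
    rw [map_smul, Pi.basisFun_apply]
    exact Submodule.smul_mem _ _ (h3 i)
  have h1 : Module.finrank κ ((Fin n → κ) ⧸ W) ≤ N := by
    rw [← finrank_top, ← hspan]
    refine (finrank_range_le_card (G' ∘ w)).trans ?_
    simp
  have h2 := W.finrank_quotient_add_finrank
  rw [Module.finrank_fin_fun] at h2
  have h3 : n ≤ N + Module.finrank κ W := h2.symm.le.trans (Nat.add_le_add_right h1 _)
  exact h3

theorem aux_minGens_spec {R : Type u} [CommRing R] (M : Type u) [AddCommGroup M] [Module R M] [Module.Finite R M] : 
    ∃ f : Fin (minGens R M) → M, Submodule.span R (Set.range f) = ⊤ := by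
  have : {n | ∃ f : Fin n → M, Submodule.span R (Set.range f) = ⊤}.Nonempty := by
    obtain ⟨n, f, hf⟩ := Module.Finite.exists_fin (R := R) (M := M)
    exact ⟨n, f, hf⟩
  exact Nat.sInf_mem this

theorem aux_hyp_of {R : Type u} [CommRing R] [IsNoetherianRing R] {E : Type u} [AddCommGroup E] [Module R E] [Module.Finite R E] {n m e : ℕ}
    (φ : (Fin m → R) →ₗ[R] (Fin n → R)) (ψ : (Fin n → R) →ₗ[R] E)
    (hψ : Function.Surjective ψ) (hφψ : LinearMap.range φ = LinearMap.ker ψ) (he : 0 < e) (hnme : n = m + e) 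
    (q : Ideal R) [hq : q.IsPrime] 
    (hG : (minGens (Localization (primeCompl' R q hq)) (LocalizedModule (primeCompl' R q hq) E)
        : WithBot ℕ∞) ≤ localDimAt R q hq + ((e - 1 : ℕ) : WithBot ℕ∞)) :
    auxHyp R (fun j => φ (Pi.single j 1)) q := by
  have hd : localDimAt R q hq = (q.height : WithBot ℕ∞) :=
    IsLocalization.AtPrime.ringKrullDim_eq_height q (Localization.AtPrime q)
  rw [hd] at hG
  obtain ⟨h, hh⟩ := ENat.ne_top_iff_exists.mp (Ideal.height_ne_top hq.ne_top)
  obtain ⟨J, hJ, hJc⟩ := aux_choose_J (A := Localization.AtPrime q) (by omega : 0 < n) 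
    (fun j i => algebraMap R (Localization.AtPrime q) (φ (Pi.single j 1) i))
  have hfin : Module.Finite (Localization.AtPrime q) (LocalizedModule q.primeCompl E) := inferInstance
  obtain ⟨w, hw⟩ := aux_minGens_spec (R := Localization.AtPrime q) (LocalizedModule q.primeCompl E)
  have h1 := aux_rank_bound φ ψ hψ hφψ q _ w hw
  rw [← hJc] at h1
  change (minGens (Localization.AtPrime q) (LocalizedModule q.primeCompl E) : WithBot ℕ∞) ≤ _ at hG
  set N := minGens (Localization.AtPrime q) (LocalizedModule q.primeCompl E)
  rw [← hh] at hG
  have hG' : N ≤ h + (e - 1) := by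
    have h0 : (((h : ℕ) : ℕ∞) : WithBot ℕ∞) = ((h : ℕ) : WithBot ℕ∞) := rfl
    rw [h0, ← Nat.cast_add, Nat.cast_le] at hG
    exact hG
  refine ⟨J, ?_, hJ⟩
  rw [← hh]
  have h3 : (Finset.univ \ J).card + J.card = m := by
    rw [Finset.card_sdiff_add_card_eq_card (Finset.subset_univ _)]; simp
  have : (Finset.univ \ J).card < h := by omega
  exact_mod_cast this

end

section
open MvPolynomial TensorProduct

def auxSymι (R : Type u) [CommRing R] (E : Type u) [AddCommGroup E] [Module R E] : E →ₗ[R] SymModAlg R E where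
  toFun x := Ideal.Quotient.mk _ (X x)
  map_add' x y := by
    have : (X (x + y) - X x - X y : MvPolynomial E R) ∈ Ideal.span (symRels R E) := 
      Ideal.subset_span (Or.inl ⟨x, y, rfl⟩)
    rw [← map_add, Ideal.Quotient.mk_eq_mk_iff_sub_mem]
    convert this using 1; ring
  map_smul' r x := by
    have : (X (r • x) - C r * X x : MvPolynomial E R) ∈ Ideal.span (symRels R E) := 
      Ideal.subset_span (Or.inr ⟨r, x, rfl⟩)
    rw [RingHom.id_apply]
    change _ = Ideal.Quotient.mk _ (r • X x)
    rw [Ideal.Quotient.mk_eq_mk_iff_sub_mem, smul_eq_C_mul]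
    exact this

def auxSymLift {R : Type u} [CommRing R] {E : Type u} [AddCommGroup E] [Module R E] {B : Type u} [CommRing B]
    [Algebra R B] (l : E →ₗ[R] B) : SymModAlg R E →ₐ[R] B :=
  Ideal.Quotient.liftₐ _ (aeval l) (by
    intro a ha
    have : Ideal.span (symRels R E) ≤ RingHom.ker (aeval (R := R) l).toRingHom := by
      refine Ideal.span_le.mpr ?_
      rintro _ (⟨x, y, rfl⟩ | ⟨r, x, rfl⟩)
      · change aeval l _ = 0
        simp
      · change aeval l _ = 0
        simp [Algebra.smul_def]
    exact this ha)

theorem auxSymLift_ι {R : Type u} [CommRing R] {E : Type u} [AddCommGroup E] [Module R E] {B : Type u} [CommRing B]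
    [Algebra R B] (l : E →ₗ[R] B) (x : E) : auxSymLift l (auxSymι R E x) = l x := by
  change aeval l (X x) = _
  simp

theorem auxSym_ext {R : Type u} [CommRing R] {E : Type u} [AddCommGroup E] [Module R E] {B : Type u} [Semiring B]
    [Algebra R B] {f g : SymModAlg R E →ₐ[R] B} (h : ∀ x, f (auxSymι R E x) = g (auxSymι R E x)) : f = g := by
  refine Ideal.Quotient.algHom_ext _ ?_
  exact MvPolynomial.algHom_ext fun x => h x

theorem aux_sym_equiv {R : Type u} [CommRing R] {E : Type u} [AddCommGroup E] [Module R E] {n m : ℕ}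
    (φ : (Fin m → R) →ₗ[R] (Fin n → R)) (ψ : (Fin n → R) →ₗ[R] E)
    (hψ : Function.Surjective ψ) (hφψ : LinearMap.range φ = LinearMap.ker ψ) :
    ∃ Θ : SymModAlg R E ≃ₐ[R] (MvPolynomial (Fin n) R ⧸ auxI R (fun j => φ (Pi.single j 1)) Finset.univ),
      ∀ w, Θ (auxSymι R E (ψ w)) = Ideal.Quotient.mk _ (auxLf R n w) := by
  set I := auxI R (fun j => φ (Pi.single j 1)) Finset.univ with hI
  let c : (Fin n → R) →ₗ[R] (MvPolynomial (Fin n) R ⧸ I) := (Ideal.Quotient.mkₐ R I).toLinearMap ∘ₗ auxLf R n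
  have hcφ : c ∘ₗ φ = 0 := by
    refine LinearMap.pi_ext' fun j => LinearMap.ext_ring ?_
    change Ideal.Quotient.mk I _ = 0
    rw [Ideal.Quotient.eq_zero_iff_mem]
    exact Ideal.subset_span ⟨j, by simp, rfl⟩
  have hc : LinearMap.ker ψ ≤ LinearMap.ker c := by
    rw [← hφψ]
    rintro _ ⟨x, rfl⟩
    exact LinearMap.congr_fun hcφ x
  let g : E →ₗ[R] (MvPolynomial (Fin n) R ⧸ I) := 
    (LinearMap.ker ψ).liftQ c hc ∘ₗ (ψ.quotKerEquivOfSurjective hψ).symm.toLinearMap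
  have hg : ∀ x, g (ψ x) = c x := by
    intro x
    have : (ψ.quotKerEquivOfSurjective hψ).symm (ψ x) = Submodule.Quotient.mk x := by
      rw [LinearEquiv.symm_apply_eq]; rfl
    simp [g, this]
  let α0 : MvPolynomial (Fin n) R →ₐ[R] SymModAlg R E := aeval (fun i => auxSymι R E (ψ (Pi.single i 1)))
  have hα0 : ∀ w, α0 (auxLf R n w) = auxSymι R E (ψ w) := by
    have : α0.toLinearMap ∘ₗ auxLf R n = auxSymι R E ∘ₗ ψ := by
      refine LinearMap.pi_ext' fun j => LinearMap.ext_ring ?_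
      simp [auxLf_single, α0]
    exact fun w => LinearMap.congr_fun this w
  have hker : ∀ a ∈ I, α0 a = 0 := by
    have : I ≤ RingHom.ker α0.toRingHom := by
      refine Ideal.span_le.mpr ?_
      rintro _ ⟨j, -, rfl⟩
      change α0 (auxLf R n (φ (Pi.single j 1))) = 0
      have h0 : ψ (φ (Pi.single j 1)) = 0 := by
        rw [← LinearMap.mem_ker, ← hφψ]; exact ⟨_, rfl⟩
      rw [hα0, h0, map_zero]
    exact fun a ha => this ha
  let α : (MvPolynomial (Fin n) R ⧸ I) →ₐ[R] SymModAlg R E := Ideal.Quotient.liftₐ I α0 hker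
  have hα : ∀ f, α (Ideal.Quotient.mk I f) = α0 f := fun f => rfl
  let β := auxSymLift g
  have hβ : ∀ w, β (auxSymι R E (ψ w)) = Ideal.Quotient.mk _ (auxLf R n w) := by
    intro w; rw [auxSymLift_ι, hg]; rfl
  refine ⟨AlgEquiv.ofAlgHom β α ?_ ?_, hβ⟩
  · refine Ideal.Quotient.algHom_ext _ (MvPolynomial.algHom_ext fun i => ?_)
    change β (α0 (X i)) = Ideal.Quotient.mk I (X i)
    rw [← auxLf_single, hα0, hβ]
  · refine auxSym_ext fun x => ?_
    obtain ⟨w, rfl⟩ := hψ x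
    rw [AlgHom.comp_apply, hβ, hα, hα0]; rfl

theorem aux_sym_torsion {R : Type u} [CommRing R] {E : Type u} [AddCommGroup E] [Module R E] {n m : ℕ}
    (φ : (Fin m → R) →ₗ[R] (Fin n → R)) (ψ : (Fin n → R) →ₗ[R] E)
    (hψ : Function.Surjective ψ) (hφψ : LinearMap.range φ = LinearMap.ker ψ) (p : Ideal R) 
    (hT : ∀ (z : MvPolynomial (Fin n) R) (a : R) (_ : a ∈ nonZeroDivisors R) 
      (_ : C a * z ∈ auxI R (fun j => φ (Pi.single j 1)) Finset.univ),
      ∃ s, s ∉ p ∧ C s * z ∈ auxI R (fun j => φ (Pi.single j 1)) Finset.univ) 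
    (y : SymModAlg R E) (hy : y ∈ torsionIdeal R (SymModAlg R E)) : ∃ s, s ∉ p ∧ s • y = 0 := by
  obtain ⟨Θ, -⟩ := aux_sym_equiv φ ψ hψ hφψ
  obtain ⟨a, ha, hay⟩ := hy
  obtain ⟨z, hz⟩ := Ideal.Quotient.mk_surjective (Θ y)
  have key : ∀ s : R, s • y = 0 ↔ C s * z ∈ auxI R (fun j => φ (Pi.single j 1)) Finset.univ := by
    intro s
    rw [← Ideal.Quotient.eq_zero_iff_mem, ← smul_eq_C_mul, ← EmbeddingLike.map_eq_zero_iff (f := Θ), map_smul, ← hz]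
    rfl
  obtain ⟨s, hs, h⟩ := hT z a ha ((key a).mp hay)
  exact ⟨s, hs, (key s).mpr h⟩

theorem aux_lemma_L {R : Type u} [CommRing R] {E : Type u} [AddCommGroup E] [Module R E] [Module.Finite R E]
    (p : PrimeSpectrum R) 
    (hT : ∀ y ∈ torsionIdeal R (SymModAlg R E), ∃ s, s ∉ p.asIdeal ∧ s • y = 0)
    (U : Submodule R E) (hU : IsReduction R E U) : p ∉ Module.support R (E ⧸ U) := by
  intro hp
  rw [Module.mem_support_iff_nontrivial_residueField_tensorProduct] at hp
  set κ := p.asIdeal.ResidueField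
  obtain ⟨y, hy⟩ := exists_ne (0 : κ ⊗[R] (E ⧸ U))
  obtain ⟨f, hf⟩ := Module.Projective.exists_dual_ne_zero κ hy
  let l : E →ₗ[R] κ := f.restrictScalars R ∘ₗ TensorProduct.mk R κ (E ⧸ U) 1 ∘ₗ U.mkQ
  have hlU : ∀ x ∈ U, l x = 0 := by
    intro x hx
    have : U.mkQ x = 0 := by simpa using hx
    simp [l, this]
  obtain ⟨x, hx⟩ : ∃ x, l x ≠ 0 := by
    by_contra hcon
    push Not at hcon
    refine hf ?_
    have : f = 0 := by
      ext z
      have := hcon z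
      simpa [l] using this
    rw [this]; rfl
  let F := auxSymLift l
  have hF : ∀ a ∈ torsionIdeal R (SymModAlg R E), F a = 0 := by
    intro a ha
    obtain ⟨s, hs, hsa⟩ := hT a ha
    have h1 : algebraMap R κ s * F a = 0 := by
      rw [← Algebra.smul_def, ← map_smul, hsa, map_zero]
    have h2 : algebraMap R κ s ≠ 0 := by
      rwa [Ne, Ideal.algebraMap_residueField_eq_zero]
    exact (mul_eq_zero.mp h1).resolve_left h2
  let G : ReesModAlg R E →ₐ[R] κ := Ideal.Quotient.liftₐ _ F hF
  have hG : ∀ x, G (reesι R E x) = l x := fun x => auxSymLift_ι l x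
  obtain ⟨r, hr⟩ := hU
  have h1 : (reesι R E x) ^ (r + 1) ∈ reesPower R E (r + 1) := 
    Submodule.subset_span ⟨fun _ => x, by simp⟩
  rw [hr] at h1
  have h2 : mulPower R E U r ≤ LinearMap.ker G.toLinearMap := by
    refine Submodule.span_le.mpr ?_
    rintro _ ⟨w, hw, g, rfl⟩
    change G _ = 0
    rw [map_mul, hG, hlU w hw, zero_mul]
  have h3 : G ((reesι R E x) ^ (r + 1)) = 0 := h2 h1
  rw [map_pow, hG] at h3
  exact hx (pow_eq_zero_iff (by simp) |>.mp h3)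

end

section
/-- local vanishing of the cokernel at every nonmaximal prime -/
def auxZ (A : Type u) [CommRing A] [IsLocalRing A] {N n : ℕ} (v : Fin N → Fin n → A) : Prop :=
  ∀ q : Ideal A, q.IsPrime → q < IsLocalRing.maximalIdeal A → 
    ∃ s, s ∉ q ∧ ∀ w : Fin n → A, s • w ∈ Submodule.span A (Set.range v)

def auxMac (n : ℕ) : Prop := ∀ (A : Type u) [CommRing A] [IsLocalRing A] [IsNoetherianRing A] (N : ℕ)
  (v : Fin N → Fin n → A), Submodule.span A (Set.range v) ≠ ⊤ → auxZ A v → 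
  (IsLocalRing.maximalIdeal A).height ≤ ((N + 1 - n : ℕ) : ℕ∞)

theorem auxMac_unit (n : ℕ) (ih : auxMac.{u} n) (A : Type u) [CommRing A] [IsLocalRing A] [IsNoetherianRing A] 
    (N : ℕ) (v : Fin (N + 1) → Fin (n + 1) → A) (hv : Submodule.span A (Set.range v) ≠ ⊤) (hZ : auxZ A v)
    (k : Fin (N + 1)) (i : Fin (n + 1)) (hu : IsUnit (v k i)) : 
    (IsLocalRing.maximalIdeal A).height ≤ ((N + 1 + 1 - (n + 1) : ℕ) : ℕ∞) := by
  obtain ⟨u, hu⟩ := hu.exists_left_inv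
  let ρ : (Fin (n + 1) → A) →ₗ[A] (Fin n → A) := LinearMap.pi fun i' =>
    LinearMap.proj (i.succAbove i') - (u * v k (i.succAbove i')) • LinearMap.proj i
  have hρ : ∀ w i', ρ w i' = w (i.succAbove i') - (u * v k (i.succAbove i')) * w i := fun w i' => rfl
  have hρk : ρ (v k) = 0 := by
    ext i'
    rw [hρ, Pi.zero_apply]
    linear_combination (- v k (i.succAbove i')) * hu
  have hker : ∀ w, ρ w = 0 → w = (u * w i) • v k := by
    intro w hw
    ext j
    rcases Fin.eq_self_or_eq_succAbove i j with rfl | ⟨i', rfl⟩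
    · simp only [Pi.smul_apply, smul_eq_mul]
      linear_combination (- w j) * hu
    · have := congrFun hw i'
      rw [hρ, Pi.zero_apply] at this
      simp only [Pi.smul_apply, smul_eq_mul]
      linear_combination this
  have hsurj : Function.Surjective ρ := by
    intro y
    refine ⟨i.insertNth 0 y, ?_⟩
    ext i'
    rw [hρ]; simp
  let v' : Fin N → Fin n → A := fun k' => ρ (v (k.succAbove k'))
  have hmap : ∀ w, ρ w ∈ Submodule.span A (Set.range v') ↔ w ∈ Submodule.span A (Set.range v) := by
    intro w
    have hv'v : Submodule.span A (Set.range v') = (Submodule.span A (Set.range v)).map ρ := by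
      rw [Submodule.map_span]
      refine le_antisymm (Submodule.span_mono ?_) (Submodule.span_le.mpr ?_)
      · rintro _ ⟨k', rfl⟩
        exact ⟨_, ⟨_, rfl⟩, rfl⟩
      · rintro _ ⟨_, ⟨j, rfl⟩, rfl⟩
        rcases Fin.eq_self_or_eq_succAbove k j with rfl | ⟨k', rfl⟩
        · rw [hρk]; exact zero_mem _
        · exact Submodule.subset_span ⟨k', rfl⟩
    rw [hv'v]
    constructor
    · rintro ⟨w', hw', hww⟩
      have h1 := hker (w - w') (by rw [map_sub, hww, sub_self])
      have h2 : w = w' + (u * (w - w') i) • v k := by rw [← h1]; abel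
      rw [h2]
      exact add_mem hw' (Submodule.smul_mem _ _ (Submodule.subset_span ⟨k, rfl⟩))
    · intro h
      exact ⟨w, h, rfl⟩
  have h1 := ih A N v' ?_ ?_
  · have h3 : N + 1 + 1 - (n + 1) = N + 1 - n := by omega
    rw [h3]; exact h1
  · intro htop
    refine hv (eq_top_iff.mpr fun w _ => ?_)
    rw [← hmap, htop]; trivial
  · intro q hq hqm
    obtain ⟨s, hs, hsw⟩ := hZ q hq hqm
    refine ⟨s, hs, fun y => ?_⟩
    obtain ⟨w, rfl⟩ := hsurj y
    rw [← map_smul, hmap]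
    exact hsw w

theorem auxMac_zero (n : ℕ) (A : Type u) [CommRing A] [IsLocalRing A] [IsNoetherianRing A] 
    (v : Fin 0 → Fin (n + 1) → A) (hZ : auxZ A v) : 
    (IsLocalRing.maximalIdeal A).height = 0 := by
  rw [Ideal.height_eq_zero_iff]
  refine ⟨⟨inferInstance, bot_le⟩, ?_⟩
  rintro q ⟨hq, -⟩ hqm
  by_contra hcon
  obtain ⟨s, hs, hsw⟩ := hZ q hq (lt_of_le_not_ge hqm hcon)
  have h1 := hsw 1
  rw [Set.range_eq_empty, Submodule.span_empty, Submodule.mem_bot] at h1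
  have h2 := congrFun h1 0
  simp at h2
  exact hs (h2 ▸ zero_mem q)

theorem auxMac_one (A : Type u) [CommRing A] [IsLocalRing A] [IsNoetherianRing A] (N : ℕ)
    (v : Fin N → Fin 1 → A) (hv : ∀ k i, v k i ∈ IsLocalRing.maximalIdeal A) (hZ : auxZ A v) : 
    (IsLocalRing.maximalIdeal A).height ≤ (N : ℕ∞) := by
  have h1 : IsLocalRing.maximalIdeal A ∈ (Ideal.span (Set.range fun k => v k 0)).minimalPrimes := by
    refine ⟨⟨inferInstance, Ideal.span_le.mpr ?_⟩, ?_⟩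
    · rintro _ ⟨k, rfl⟩; exact hv k 0
    · rintro q ⟨hq, hle⟩ hqm
      by_contra hcon
      obtain ⟨s, hs, hsw⟩ := hZ q hq (lt_of_le_not_ge hqm hcon)
      refine hs ?_
      have h2 := hsw 1
      have h3 : Submodule.span A (Set.range v) ≤ Submodule.comap (LinearMap.proj 0) q := by
        refine Submodule.span_le.mpr ?_
        rintro _ ⟨k, rfl⟩
        exact hle (Ideal.subset_span ⟨k, rfl⟩)
      simpa using h3 h2
  refine (Ideal.height_le_card_of_mem_minimalPrimes_span (Set.finite_range _) h1).trans ?_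
  have := Set.ncard_image_le (f := fun k => v k 0) (s := Set.univ) Set.finite_univ
  rw [Set.image_univ, Set.ncard_univ, Nat.card_eq_fintype_card, Fintype.card_fin] at this
  exact_mod_cast this

end

section
open Polynomial

theorem aux_chain_poly {S : Type u} [CommRing S] [IsNoetherianRing S] (Q P N : Ideal S) [Q.IsPrime] [P.IsPrime] [N.IsPrime]
    (h1 : Q < P) (h2 : P < N) (x : S) (h : N ∈ (Q ⊔ Ideal.span {x}).minimalPrimes) : False := by
  have h3 := Ideal.map_height_le_one_of_mem_minimalPrimes h
  have hs : Function.Surjective (Ideal.Quotient.mk Q) := Ideal.Quotient.mk_surjective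
  have hc : ∀ J : Ideal S, Q ≤ J → (J.map (Ideal.Quotient.mk Q)).comap (Ideal.Quotient.mk Q) = J := by
    intro J hJ
    rw [Ideal.comap_map_of_surjective _ hs, ← RingHom.ker_eq_comap_bot, Ideal.mk_ker, sup_eq_left.mpr hJ]
  have hp : (P.map (Ideal.Quotient.mk Q)).IsPrime := Ideal.map_isPrime_of_surjective hs (by rw [Ideal.mk_ker]; exact h1.le)
  have hn : (N.map (Ideal.Quotient.mk Q)).IsPrime := Ideal.map_isPrime_of_surjective hs (by rw [Ideal.mk_ker]; exact (h1.trans h2).le)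
  have hlt1 : (⊥ : Ideal (S ⧸ Q)) < P.map (Ideal.Quotient.mk Q) := by
    refine lt_of_le_of_ne bot_le fun heq => h1.ne ?_
    rw [← hc P h1.le, ← heq, ← RingHom.ker_eq_comap_bot, Ideal.mk_ker]
  have hlt2 : P.map (Ideal.Quotient.mk Q) < N.map (Ideal.Quotient.mk Q) := by
    refine lt_of_le_of_ne (Ideal.map_mono h2.le) fun heq => h2.ne ?_
    rw [← hc P h1.le, heq, hc N (h1.trans h2).le]
  have hb : (⊥ : Ideal (S ⧸ Q)).IsPrime := Ideal.isPrime_bot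
  have e1 := Ideal.height_add_one_le_of_lt_of_isPrime hlt1
  have e2 := Ideal.height_add_one_le_of_lt_of_isPrime hlt2
  have e3 := e2.trans h3
  have e4 : (1 : ℕ∞) ≤ (P.map (Ideal.Quotient.mk Q)).height := le_trans (by simp) e1
  have e5 : (1 : ℕ∞) + 1 ≤ 1 := le_trans (by gcongr) e3
  exact absurd e5 (by decide)

theorem aux_poly_Z (A : Type u) [CommRing A] [IsLocalRing A] [IsNoetherianRing A] {N n : ℕ} (v : Fin N → Fin n → A) 
    (hZ : auxZ A v) (d v' : Fin N → Fin n → A[X]) (hv' : ∀ k i, v' k i = C (v k i) + X * d k i)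
    (Q : Ideal A[X]) [Q.IsPrime] (hQ : Q < (IsLocalRing.maximalIdeal A).map C) :
    ∃ s, s ∉ Q ∧ ∀ w : Fin n → A[X], s • w ∈ Submodule.span A[X] (Set.range v') := by
  by_contra hcon
  push Not at hcon
  let 𝔪 := IsLocalRing.maximalIdeal A
  let S' := Submodule.span A[X] (Set.range v')
  have hann : Module.annihilator A[X] ((Fin n → A[X]) ⧸ S') ≤ Q := by
    intro s hs
    by_contra hsQ
    obtain ⟨w, hw⟩ := hcon s hsQ
    apply hw
    have := Module.mem_annihilator.mp hs (Submodule.Quotient.mk w)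
    rwa [← Submodule.Quotient.mk_smul, Submodule.Quotient.mk_eq_zero] at this
  have hPp : ((IsLocalRing.maximalIdeal A).map (C : A →+* A[X])).IsPrime := Ideal.isPrime_map_C_of_isPrime
  let 𝔫 : Ideal A[X] := Ideal.comap constantCoeff 𝔪
  have hnp : 𝔫.IsPrime := Ideal.comap_isPrime _ _
  have hXn : (X : A[X]) ∈ 𝔫 := by change constantCoeff X ∈ 𝔪; simp
  have hle : (IsLocalRing.maximalIdeal A).map (C : A →+* A[X]) ≤ 𝔫 := by
    rw [Ideal.map_le_iff_le_comap]
    intro a ha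
    change constantCoeff (C a) ∈ 𝔪
    rw [constantCoeff_apply, coeff_C_zero]; exact ha
  have hlt : (IsLocalRing.maximalIdeal A).map (C : A →+* A[X]) < 𝔫 := by
    refine lt_of_le_not_ge hle fun h => ?_
    have := Ideal.mem_map_C_iff.mp (h hXn) 1
    rw [coeff_X_one] at this
    exact (Ideal.ne_top_iff_one _).mp (IsLocalRing.maximalIdeal.isMaximal A).ne_top this
  refine aux_chain_poly Q _ 𝔫 hQ hlt X ⟨⟨hnp, sup_le (hQ.le.trans hle) ?_⟩, ?_⟩
  · rw [Ideal.span_le, Set.singleton_subset_iff]; exact hXn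
  · rintro P ⟨hP, hQP⟩ hPn
    have hXP : X ∈ P := hQP (Ideal.mem_sup_right (Ideal.mem_span_singleton_self _))
    suffices hm : ∀ a ∈ 𝔪, C a ∈ P by
      intro f hf
      rw [← divX_mul_X_add f]
      exact add_mem (P.mul_mem_left _ hXP) (hm _ hf)
    by_contra hcon2
    push Not at hcon2
    obtain ⟨a, ha, haP⟩ := hcon2
    have hpm : P.comap C ≤ 𝔪 := by
      intro b hb
      have : C b ∈ 𝔫 := hPn hb
      change constantCoeff (C b) ∈ 𝔪 at this
      simpa using this
    obtain ⟨s, hs, hsw⟩ := hZ (P.comap C) (Ideal.comap_isPrime _ _) (lt_of_le_not_ge hpm fun h => haP (h ha))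
    apply hs
    have h1 : (⟨P, hP⟩ : PrimeSpectrum A[X]) ∈ Module.support A[X] 
        (((Fin n → A[X]) ⧸ S') ⧸ ((Ideal.span {X} : Ideal A[X]) • ⊤ : Submodule A[X] ((Fin n → A[X]) ⧸ S'))) := by
      rw [Module.support_quotient]
      refine ⟨Module.mem_support_iff_of_finite.mpr (hann.trans (le_sup_left.trans hQP)), ?_⟩
      change ((Ideal.span {X} : Ideal A[X]) : Set A[X]) ⊆ P
      exact (Ideal.span_singleton_le_iff_mem _).mpr hXP
    apply Module.annihilator_le_of_mem_support h1
    rw [Module.mem_annihilator]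
    intro y
    obtain ⟨y, rfl⟩ := Submodule.Quotient.mk_surjective _ y
    obtain ⟨w, rfl⟩ := Submodule.Quotient.mk_surjective _ y
    rw [← Submodule.Quotient.mk_smul, Submodule.Quotient.mk_eq_zero]
    have key : ∀ w0 : Fin n → A, w0 ∈ Submodule.span A (Set.range v) → 
        Submodule.Quotient.mk (p := S') (fun i => C (w0 i)) ∈ ((Ideal.span {X} : Ideal A[X]) • ⊤ : Submodule A[X] ((Fin n → A[X]) ⧸ S')) := by
      intro w0 hw0
      induction hw0 using Submodule.span_induction with
      | mem x hx => 
        obtain ⟨k, rfl⟩ := hx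
        have : (fun i => C (v k i)) = v' k - (X : A[X]) • d k := by
          ext1 i; simp [hv']
        rw [this, Submodule.Quotient.mk_sub, (Submodule.Quotient.mk_eq_zero S').mpr (Submodule.subset_span ⟨k, rfl⟩), zero_sub,
          Submodule.Quotient.mk_smul]
        exact neg_mem (Submodule.smul_mem_smul (Ideal.mem_span_singleton_self _) trivial)
      | zero => 
        have : (fun i : Fin n => C ((0 : Fin n → A) i)) = 0 := by ext1 i; simp
        rw [this, Submodule.Quotient.mk_zero]; exact zero_mem _
      | add x y hx hy h1 h2 => 
        have : (fun i : Fin n => C ((x + y) i)) = (fun i => C (x i)) + fun i => C (y i) := by ext1 i; simp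
        rw [this, Submodule.Quotient.mk_add]; exact add_mem h1 h2
      | smul a x hx h1 => 
        have : (fun i : Fin n => C ((a • x) i)) = (C a : A[X]) • (fun i => C (x i)) := by ext1 i; simp
        rw [this, Submodule.Quotient.mk_smul]; exact Submodule.smul_mem _ _ h1
    have hw : w = ∑ i, w i • (Pi.single i 1 : Fin n → A[X]) := by
      ext1 j
      simp [Finset.sum_apply, Pi.single_apply]
    rw [← Submodule.Quotient.mk_smul, hw, Finset.smul_sum]
    change Submodule.mkQ S' _ ∈ _
    rw [map_sum]
    refine sum_mem fun i _ => ?_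
    rw [smul_comm, map_smul]
    refine Submodule.smul_mem _ _ ?_
    convert key (s • Pi.single i 1) (hsw _) using 1
    rw [Submodule.mkQ_apply]
    congr 1
    ext1 j
    by_cases hij : j = i
    · subst hij; simp
    · simp [hij]

theorem auxMac_poly (n : ℕ) (ih : auxMac.{u} (n + 1)) (A : Type u) [CommRing A] [IsLocalRing A] [IsNoetherianRing A] (N : ℕ)
    (v : Fin (N + 1) → Fin (n + 2) → A) (hv : ∀ k i, v k i ∈ IsLocalRing.maximalIdeal A) (hZ : auxZ A v) : 
    (IsLocalRing.maximalIdeal A).height ≤ ((N + 1 + 1 - (n + 2) : ℕ) : ℕ∞) := by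
  let 𝔓 : Ideal A[X] := (IsLocalRing.maximalIdeal A).map C
  haveI hPp : 𝔓.IsPrime := Ideal.isPrime_map_C_of_isPrime
  let B := Localization.AtPrime 𝔓
  let d : Fin (N + 1) → Fin (n + 2) → A[X] := fun k i => if k = 0 ∧ i = 0 then 1 else 0
  let v' : Fin (N + 1) → Fin (n + 2) → A[X] := fun k i => C (v k i) + X * d k i
  let vB : Fin (N + 1) → Fin (n + 2) → B := fun k i => algebraMap A[X] B (v' k i)
  have hB : IsNoetherianRing B := IsLocalization.isNoetherianRing 𝔓.primeCompl B inferInstance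
  have hmem : ∀ f : A[X], algebraMap A[X] B f ∈ IsLocalRing.maximalIdeal B ↔ f ∈ 𝔓 := fun f => 
    IsLocalization.AtPrime.to_map_mem_maximal_iff B 𝔓 f
  have hht : (IsLocalRing.maximalIdeal B).height = (IsLocalRing.maximalIdeal A).height := by
    rw [← IsLocalization.height_under 𝔓.primeCompl, IsLocalization.AtPrime.under_maximalIdeal B 𝔓, height_map_C]
  rw [← hht]
  refine auxMac_unit (n + 1) ih B N vB ?_ ?_ 0 0 ?_
  · intro htop
    have h1 : Submodule.span B (Set.range vB) ≤ Submodule.comap (LinearMap.proj 1) (IsLocalRing.maximalIdeal B) := by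
      refine Submodule.span_le.mpr ?_
      rintro _ ⟨k, rfl⟩
      change algebraMap A[X] B (v' k 1) ∈ IsLocalRing.maximalIdeal B
      rw [hmem]
      have : v' k 1 = C (v k 1) := by simp [v', d]
      rw [this]
      exact Ideal.mem_map_of_mem _ (hv k 1)
    rw [htop] at h1
    have h2 : (1 : B) ∈ IsLocalRing.maximalIdeal B := h1 (Submodule.mem_top (x := (1 : Fin (n + 2) → B)))
    exact (Ideal.ne_top_iff_one _).mp (IsLocalRing.maximalIdeal.isMaximal B).ne_top h2
  · intro q hq hqm
    have hqp : q.comap (algebraMap A[X] B) ≤ 𝔓 := fun f hf => (hmem f).mp (hqm.le hf)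
    have hlt : q.comap (algebraMap A[X] B) < 𝔓 := by
      refine lt_of_le_of_ne hqp fun heq => hqm.ne ?_
      have e1 := IsLocalization.map_comap 𝔓.primeCompl B q
      have e2 := IsLocalization.map_comap 𝔓.primeCompl B (IsLocalRing.maximalIdeal B)
      rw [← e1, ← e2]
      congr 1
      change q.comap (algebraMap A[X] B) = (IsLocalRing.maximalIdeal B).comap (algebraMap A[X] B)
      rw [heq]
      ext f
      exact (hmem f).symm
    haveI : (q.comap (algebraMap A[X] B)).IsPrime := Ideal.comap_isPrime _ _
    obtain ⟨s, hs, hsw⟩ := aux_poly_Z A v hZ d v' (fun k i => rfl) _ hlt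
    refine ⟨algebraMap A[X] B s, hs, fun w => ?_⟩
    have key : ∀ w0 : Fin (n + 2) → A[X], w0 ∈ Submodule.span A[X] (Set.range v') → 
        (fun i => algebraMap A[X] B (w0 i)) ∈ Submodule.span B (Set.range vB) := by
      intro w0 hw0
      induction hw0 using Submodule.span_induction with
      | mem x hx => 
        obtain ⟨k, rfl⟩ := hx
        exact Submodule.subset_span ⟨k, rfl⟩
      | zero => 
        convert zero_mem (Submodule.span B (Set.range vB)) using 1
        ext1 i; simp
      | add x y hx hy h1 h2 => 
        convert add_mem h1 h2 using 1
        ext1 i; simp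
      | smul a x hx h1 => 
        convert Submodule.smul_mem _ (algebraMap A[X] B a) h1 using 1
        ext1 i; simp
    have hw : w = ∑ i, w i • (Pi.single i 1 : Fin (n + 2) → B) := by
      ext1 j
      simp [Finset.sum_apply, Pi.single_apply]
    rw [hw, Finset.smul_sum]
    refine sum_mem fun i _ => ?_
    rw [smul_comm]
    refine Submodule.smul_mem _ _ ?_
    convert key (s • Pi.single i 1) (hsw _) using 1
    ext1 j
    by_cases hij : j = i
    · subst hij; simp
    · simp [hij]
  · have h1 : vB 0 0 ∉ IsLocalRing.maximalIdeal B := by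
      change algebraMap A[X] B (v' 0 0) ∉ _
      rw [hmem]
      intro h
      have h2 := Ideal.mem_map_C_iff.mp h 1
      have : (v' 0 0).coeff 1 = 1 := by simp [v', d, coeff_C]
      rw [this] at h2
      exact (Ideal.ne_top_iff_one _).mp (IsLocalRing.maximalIdeal.isMaximal A).ne_top h2
    simpa using h1

theorem aux_macaulay (n : ℕ) : auxMac.{u} n := by
  induction n with
  | zero => 
    intro A _ _ _ N v hv _
    exact absurd (Subsingleton.elim _ _) hv
  | succ n ih =>
    intro A _ _ _ N v hv hZ
    rcases N with _ | N
    · rw [auxMac_zero n A v hZ]; exact zero_le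
    by_cases hu : ∃ k i, IsUnit (v k i)
    · obtain ⟨k, i, hu⟩ := hu
      exact auxMac_unit n ih A N v hv hZ k i hu
    push Not at hu
    have hvm : ∀ k i, v k i ∈ IsLocalRing.maximalIdeal A := fun k i => hu k i
    rcases n with _ | n
    · exact auxMac_one A _ v hvm hZ
    · exact auxMac_poly n ih A N v hvm hZ

end

section
open Polynomial

def auxRι (R : Type u) [CommRing R] (E : Type u) [AddCommGroup E] [Module R E] : E →ₗ[R] ReesModAlg R E :=
  (Ideal.Quotient.mkₐ R (torsionIdeal R (SymModAlg R E))).toLinearMap ∘ₗ auxSymι R E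

theorem auxRι_apply (R : Type u) [CommRing R] (E : Type u) [AddCommGroup E] [Module R E] (x : E) :
    auxRι R E x = reesι R E x := rfl

theorem auxRees_ext {R : Type u} [CommRing R] {E : Type u} [AddCommGroup E] [Module R E] {B : Type u} [CommRing B]
    [Algebra R B] {f g : ReesModAlg R E →ₐ[R] B} (h : ∀ x, f (auxRι R E x) = g (auxRι R E x)) : f = g := by
  refine Ideal.Quotient.algHom_ext _ ?_
  exact auxSym_ext fun x => h x

theorem auxRees_tf {R : Type u} [CommRing R] {E : Type u} [AddCommGroup E] [Module R E] 
    (r : R) (hr : r ∈ nonZeroDivisors R) (b : ReesModAlg R E) (h : r • b = 0) : b = 0 := by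
  obtain ⟨b, rfl⟩ := Ideal.Quotient.mk_surjective b
  have h1 : Ideal.Quotient.mk (torsionIdeal R (SymModAlg R E)) (r • b) = 0 := h
  rw [Ideal.Quotient.eq_zero_iff_mem] at h1 ⊢
  obtain ⟨s, hs, h2⟩ := h1
  exact ⟨s * r, mul_mem hs hr, by rw [mul_smul, h2]⟩

def auxReesLift {R : Type u} [CommRing R] {E : Type u} [AddCommGroup E] [Module R E] {B : Type u} [CommRing B]
    [Algebra R B] (l : E →ₗ[R] B) (htf : ∀ r ∈ nonZeroDivisors R, ∀ b : B, r • b = 0 → b = 0) : ReesModAlg R E →ₐ[R] B :=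
  Ideal.Quotient.liftₐ _ (auxSymLift l) (by
    rintro a ⟨r, hr, h⟩
    refine htf r hr _ ?_
    rw [← map_smul, h, map_zero])

theorem auxReesLift_ι {R : Type u} [CommRing R] {E : Type u} [AddCommGroup E] [Module R E] {B : Type u} [CommRing B]
    [Algebra R B] (l : E →ₗ[R] B) (htf : ∀ r ∈ nonZeroDivisors R, ∀ b : B, r • b = 0 → b = 0) (x : E) : 
    auxReesLift l htf (auxRι R E x) = l x := auxSymLift_ι l x

theorem auxRees_induction {R : Type u} [CommRing R] {E : Type u} [AddCommGroup E] [Module R E] 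
    (P : ReesModAlg R E → Prop) (h0 : ∀ r, P (algebraMap R _ r)) (hadd : ∀ a b, P a → P b → P (a + b)) 
    (hmul : ∀ a x, P a → P (a * auxRι R E x)) (a : ReesModAlg R E) : P a := by
  obtain ⟨a, rfl⟩ := Ideal.Quotient.mk_surjective a
  obtain ⟨a, rfl⟩ := Ideal.Quotient.mk_surjective a
  induction a using MvPolynomial.induction_on with
  | C r => exact h0 r
  | add p q hp hq => rw [map_add, map_add]; exact hadd _ _ hp hq
  | mul_X p x hp => rw [map_mul, map_mul]; exact hmul _ x hp

def auxγ (R : Type u) [CommRing R] (E : Type u) [AddCommGroup E] [Module R E] : ReesModAlg R E →ₐ[R] (ReesModAlg R E)[X] :=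
  auxReesLift ((monomial 1 : ReesModAlg R E →ₗ[ReesModAlg R E] (ReesModAlg R E)[X]).restrictScalars R ∘ₗ auxRι R E) (by
    intro r hr b hb
    ext j
    refine auxRees_tf r hr _ ?_
    rw [← coeff_smul, hb, coeff_zero])

theorem auxγ_ι (R : Type u) [CommRing R] (E : Type u) [AddCommGroup E] [Module R E] (x : E) : 
    auxγ R E (auxRι R E x) = monomial 1 (auxRι R E x) := auxReesLift_ι _ _ _

def auxε (R : Type u) [CommRing R] (E : Type u) [AddCommGroup E] [Module R E] : ReesModAlg R E →ₐ[R] R :=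
  auxReesLift 0 (by
    intro r hr b hb
    rw [smul_eq_mul, mul_comm] at hb
    exact (mem_nonZeroDivisors_iff.mp hr).2 _ hb)

theorem auxε_ι (R : Type u) [CommRing R] (E : Type u) [AddCommGroup E] [Module R E] (x : E) : 
    auxε R E (auxRι R E x) = 0 := auxReesLift_ι _ _ _

theorem auxγ_eval (R : Type u) [CommRing R] (E : Type u) [AddCommGroup E] [Module R E] (a : ReesModAlg R E) :
    (auxγ R E a).eval 1 = a := by
  induction a using auxRees_induction with
  | h0 r => 
    rw [AlgHom.commutes, Polynomial.algebraMap_apply, eval_C]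
  | hadd a b ha hb => rw [map_add, eval_add, ha, hb]
  | hmul a x ha => rw [map_mul, eval_mul, ha, auxγ_ι, eval_monomial]; simp

theorem auxγ_zero (R : Type u) [CommRing R] (E : Type u) [AddCommGroup E] [Module R E] (a : ReesModAlg R E) :
    (auxγ R E a).coeff 0 = algebraMap R _ (auxε R E a) := by
  induction a using auxRees_induction with
  | h0 r => 
    rw [AlgHom.commutes, Polynomial.algebraMap_apply, coeff_C_zero, AlgHom.commutes]; rfl
  | hadd a b ha hb => rw [map_add, coeff_add, ha, hb, map_add, map_add]
  | hmul a x ha => rw [map_mul, mul_coeff_zero, ha, auxγ_ι, map_mul, auxε_ι]; simp [coeff_monomial]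

theorem aux_reesPower (R : Type u) [CommRing R] (E : Type u) [AddCommGroup E] [Module R E] (j : ℕ) :
    reesPower R E j = (LinearMap.range (auxRι R E)) ^ j := by
  rw [Submodule.pow_eq_span_pow_set, reesPower]
  congr 1
  ext a
  rw [Set.mem_pow]
  constructor
  · rintro ⟨f, rfl⟩
    refine ⟨fun i => ⟨_, ⟨f i, rfl⟩⟩, ?_⟩
    rw [List.prod_ofFn]; rfl
  · rintro ⟨f, rfl⟩
    choose g hg using fun i => (f i).2
    refine ⟨g, ?_⟩
    rw [List.prod_ofFn]
    exact Finset.prod_congr rfl fun i _ => (hg i).symm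

theorem aux_mulPower (R : Type u) [CommRing R] (E : Type u) [AddCommGroup E] [Module R E] (U : Submodule R E) (r : ℕ) :
    mulPower R E U r = (U.map (auxRι R E)) * reesPower R E r := by
  rw [← Submodule.span_eq (U.map (auxRι R E)), reesPower, Submodule.span_mul_span, mulPower]
  congr 1
  ext a
  constructor
  · rintro ⟨u, hu, f, rfl⟩
    exact Set.mul_mem_mul ⟨u, hu, rfl⟩ ⟨f, rfl⟩
  · rintro ⟨_, ⟨u, hu, rfl⟩, _, ⟨f, rfl⟩, rfl⟩
    exact ⟨u, hu, f, rfl⟩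

theorem auxγ_coeff_mem (R : Type u) [CommRing R] (E : Type u) [AddCommGroup E] [Module R E] (a : ReesModAlg R E) (j : ℕ) :
    (auxγ R E a).coeff j ∈ reesPower R E j := by
  induction a using auxRees_induction generalizing j with
  | h0 r => 
    rw [AlgHom.commutes, Polynomial.algebraMap_apply, coeff_C]
    split_ifs with h
    · subst h
      rw [aux_reesPower, pow_zero]
      exact Submodule.algebraMap_mem r
    · exact zero_mem _
  | hadd a b ha hb => rw [map_add, coeff_add]; exact add_mem (ha j) (hb j)
  | hmul a x ha => 
    rw [map_mul, auxγ_ι]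
    rcases j with _ | j
    · rw [mul_coeff_zero, coeff_monomial]; simp
    · rw [coeff_mul_monomial, aux_reesPower, pow_succ, ← aux_reesPower]
      exact Submodule.mul_mem_mul (ha j) ⟨x, rfl⟩

theorem auxγ_power (R : Type u) [CommRing R] (E : Type u) [AddCommGroup E] [Module R E] (a : ReesModAlg R E) (j : ℕ)
    (ha : a ∈ reesPower R E j) : auxγ R E a = monomial j a := by
  have : reesPower R E j ≤ LinearMap.ker ((auxγ R E).toLinearMap - 
      ((monomial j : ReesModAlg R E →ₗ[ReesModAlg R E] (ReesModAlg R E)[X]).restrictScalars R)) := by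
    rw [reesPower, Submodule.span_le]
    rintro _ ⟨f, rfl⟩
    simp only [SetLike.mem_coe, LinearMap.mem_ker, LinearMap.sub_apply, AlgHom.toLinearMap_apply, LinearMap.restrictScalars_apply]
    rw [map_prod, sub_eq_zero]
    have h1 : ∀ i, auxγ R E (reesι R E (f i)) = C (reesι R E (f i)) * X ^ 1 := by
      intro i; rw [← auxRι_apply, auxγ_ι, C_mul_X_pow_eq_monomial]
    simp_rw [h1]
    rw [Finset.prod_mul_distrib, ← map_prod, ← C_mul_X_pow_eq_monomial]
    simp
  exact sub_eq_zero.mp (this ha)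

theorem aux_mv_surj (R : Type u) [CommRing R] (E : Type u) [AddCommGroup E] [Module R E] {n : ℕ} (g : Fin n → E) 
    (hg : Submodule.span R (Set.range g) = ⊤) : 
    Function.Surjective (MvPolynomial.aeval (R := R) fun i => auxRι R E (g i)) := by
  intro a
  change a ∈ (MvPolynomial.aeval (R := R) fun i => auxRι R E (g i)).range
  induction a using auxRees_induction with
  | h0 r => exact algebraMap_mem _ _
  | hadd a b ha hb => exact add_mem ha hb
  | hmul a x ha => 
    refine mul_mem ha ?_
    have : (⊤ : Submodule R E) ≤ ((MvPolynomial.aeval (R := R) fun i => auxRι R E (g i)).range.toSubmodule).comap (auxRι R E) := by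
      rw [← hg, Submodule.span_le]
      rintro _ ⟨i, rfl⟩
      exact ⟨MvPolynomial.X i, by simp⟩
    exact this (Submodule.mem_top (x := x))

theorem aux_rees_noeth (R : Type u) [CommRing R] [IsNoetherianRing R] (E : Type u) [AddCommGroup E] [Module R E] [Module.Finite R E] :
    IsNoetherianRing (ReesModAlg R E) := by
  obtain ⟨g, hg⟩ := aux_minGens_spec (R := R) E
  exact isNoetherianRing_of_surjective _ _ (MvPolynomial.aeval (R := R) fun i => auxRι R E (g i)).toRingHom (aux_mv_surj R E g hg)

theorem aux_spread_le (R : Type u) [CommRing R] [IsLocalRing R] [IsNoetherianRing R] (E : Type u) [AddCommGroup E] [Module R E] [Module.Finite R E] :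
    analyticSpread R E ≤ (minGens R E : WithBot ℕ∞) := by
  obtain ⟨g, hg⟩ := aux_minGens_spec (R := R) E
  let S := ReesModAlg R E ⧸ fiberIdeal R E
  let ρ : ReesModAlg R E →+* S := Ideal.Quotient.mk _
  let f0 : IsLocalRing.ResidueField R →+* S := Ideal.Quotient.lift _ (ρ.comp (algebraMap R (ReesModAlg R E))) (by
    intro a ha
    rw [RingHom.comp_apply, Ideal.Quotient.eq_zero_iff_mem]
    exact Ideal.mem_map_of_mem _ ha)
  let f : MvPolynomial (Fin (minGens R E)) (IsLocalRing.ResidueField R) →+* S := 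
    MvPolynomial.eval₂Hom f0 fun i => ρ (auxRι R E (g i))
  have hf : f.comp (MvPolynomial.map (IsLocalRing.residue R)) = ρ.comp (MvPolynomial.aeval (R := R) fun i => auxRι R E (g i)).toRingHom := by
    refine MvPolynomial.ringHom_ext (fun r => ?_) fun i => ?_
    · simp only [RingHom.comp_apply, MvPolynomial.map_C, f, MvPolynomial.coe_eval₂Hom, MvPolynomial.eval₂_C]
      change _ = ρ (MvPolynomial.aeval _ (MvPolynomial.C r))
      rw [MvPolynomial.aeval_C]
      rfl
    · simp only [RingHom.comp_apply, MvPolynomial.map_X, f, MvPolynomial.coe_eval₂Hom, MvPolynomial.eval₂_X]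
      change _ = ρ (MvPolynomial.aeval _ (MvPolynomial.X i))
      rw [MvPolynomial.aeval_X]
  have hs : Function.Surjective f := by
    have h1 : Function.Surjective (ρ.comp (MvPolynomial.aeval (R := R) fun i => auxRι R E (g i)).toRingHom) := 
      Ideal.Quotient.mk_surjective.comp (aux_mv_surj R E g hg)
    rw [← hf] at h1
    exact Function.Surjective.of_comp h1
  have h2 := ringKrullDim_le_of_surjective f hs
  rw [MvPolynomial.ringKrullDim_of_isNoetherianRing, ringKrullDim_eq_zero_of_field, zero_add, Nat.card_eq_fintype_card, Fintype.card_fin] at h2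
  exact h2

end

section
open Polynomial

theorem aux_avoid (R : Type u) [CommRing R] [IsLocalRing R] [Infinite (IsLocalRing.ResidueField R)] (E : Type u) [AddCommGroup E] [Module R E]
    (T : Set (Submodule R E)) (hT : T.Finite) (hT1 : ∀ W ∈ T, W ≠ ⊤) 
    (hT2 : ∀ W ∈ T, (IsLocalRing.maximalIdeal R) • (⊤ : Submodule R E) ≤ W) : ∃ x, ∀ W ∈ T, x ∉ W := by
  classical
  let 𝔪 := IsLocalRing.maximalIdeal R
  let V := E ⧸ (𝔪 • ⊤ : Submodule R E)
  let k := R ⧸ 𝔪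
  let hfield : Field k := Ideal.Quotient.field 𝔪
  have hinf : Infinite k := ‹Infinite (IsLocalRing.ResidueField R)›
  let F : Submodule R E → Submodule k V := fun W => 
    { carrier := W.map (Submodule.mkQ (𝔪 • ⊤ : Submodule R E))
      zero_mem' := zero_mem (W.map (Submodule.mkQ (𝔪 • ⊤ : Submodule R E)))
      add_mem' := fun {a b} ha hb => add_mem (S := Submodule R V) ha hb
      smul_mem' := by
        intro c x hx
        obtain ⟨r, rfl⟩ := Ideal.Quotient.mk_surjective c
        exact Submodule.smul_mem (W.map (Submodule.mkQ (𝔪 • ⊤ : Submodule R E))) r hx }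
  have hF : ∀ W ∈ T, ∀ x, Submodule.mkQ (𝔪 • ⊤ : Submodule R E) x ∈ F W → x ∈ W := by
    rintro W hW x ⟨y, hy, hxy⟩
    have h1 : x - y ∈ (𝔪 • ⊤ : Submodule R E) := by
      rw [← Submodule.ker_mkQ (𝔪 • ⊤ : Submodule R E), LinearMap.mem_ker, map_sub, hxy, sub_self]
    have := add_mem (hT2 W hW h1) hy
    simpa using this
  have h := Subspace.biUnion_ne_univ_of_top_notMem (k := k) (E := V) (s := (hT.image F).toFinset) (by
    rw [Set.Finite.mem_toFinset]
    rintro ⟨W, hW, htop⟩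
    refine hT1 W hW (eq_top_iff.mpr fun x _ => hF W hW x ?_)
    rw [htop]; trivial)
  rw [Set.ne_univ_iff_exists_notMem] at h
  obtain ⟨y, hy⟩ := h
  obtain ⟨x, rfl⟩ := Submodule.mkQ_surjective _ y
  refine ⟨x, fun W hW hxW => hy ?_⟩
  simp only [Set.mem_iUnion]
  exact ⟨F W, (Set.Finite.mem_toFinset _).mpr ⟨W, hW, rfl⟩, ⟨x, hxW, rfl⟩⟩

theorem aux_height_lt {S : Type u} [CommRing S] (F P N : Ideal S) [P.IsPrime] [N.IsPrime]
    (h1 : F ≤ P) (h2 : P < N) : (P.map (Ideal.Quotient.mk F)).height + 1 ≤ (N.map (Ideal.Quotient.mk F)).height := by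
  have hs : Function.Surjective (Ideal.Quotient.mk F) := Ideal.Quotient.mk_surjective
  have hc : ∀ J : Ideal S, F ≤ J → (J.map (Ideal.Quotient.mk F)).comap (Ideal.Quotient.mk F) = J := by
    intro J hJ
    rw [Ideal.comap_map_of_surjective _ hs, ← RingHom.ker_eq_comap_bot, Ideal.mk_ker, sup_eq_left.mpr hJ]
  have hp : (P.map (Ideal.Quotient.mk F)).IsPrime := Ideal.map_isPrime_of_surjective hs (by rw [Ideal.mk_ker]; exact h1)
  have hn : (N.map (Ideal.Quotient.mk F)).IsPrime := Ideal.map_isPrime_of_surjective hs (by rw [Ideal.mk_ker]; exact h1.trans h2.le)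
  have hlt2 : P.map (Ideal.Quotient.mk F) < N.map (Ideal.Quotient.mk F) := by
    refine lt_of_le_of_ne (Ideal.map_mono h2.le) fun heq => h2.ne ?_
    rw [← hc P h1, heq, hc N (h1.trans h2.le)]
  exact Ideal.height_add_one_le_of_lt_of_isPrime hlt2

theorem aux_choose_u (R : Type u) [CommRing R] [IsLocalRing R] [IsNoetherianRing R] [Infinite (IsLocalRing.ResidueField R)] 
    (E : Type u) [AddCommGroup E] [Module R E] [Module.Finite R E] (i : ℕ) : 
    ∃ u : Fin i → E, ∀ P : Ideal (ReesModAlg R E), P.IsPrime → fiberIdeal R E ≤ P → (∀ k, auxRι R E (u k) ∈ P) → 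
      (∃ x, auxRι R E x ∉ P) → (i : ℕ∞) ≤ (P.map (Ideal.Quotient.mk (fiberIdeal R E))).height := by
  induction i with
  | zero => exact ⟨Fin.elim0, fun P _ _ _ _ => by simp⟩
  | succ i ih =>
    obtain ⟨u, hu⟩ := ih
    have := aux_rees_noeth R E
    let J : Ideal (ReesModAlg R E) := fiberIdeal R E ⊔ Ideal.span (Set.range fun k => auxRι R E (u k))
    let W : Ideal (ReesModAlg R E) → Submodule R E := fun P => (P.restrictScalars R).comap (auxRι R E)
    obtain ⟨x, hx⟩ := aux_avoid R E (W '' {P ∈ J.minimalPrimes | ∃ x, auxRι R E x ∉ P}) 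
      (((Ideal.finite_minimalPrimes_of_isNoetherianRing (ReesModAlg R E) J).subset fun P hP => hP.1).image W) (by
        rintro _ ⟨P, ⟨hP, y, hy⟩, rfl⟩ htop
        exact hy (by
          have : y ∈ W P := by rw [htop]; trivial
          exact this)) (by
        rintro _ ⟨P, ⟨hP, y, hy⟩, rfl⟩
        rw [Submodule.smul_le]
        intro r hr z _
        change auxRι R E (r • z) ∈ P
        rw [map_smul, Algebra.smul_def]
        exact P.mul_mem_right _ (hP.1.2 (Ideal.mem_sup_left (Ideal.mem_map_of_mem _ hr))))
    refine ⟨Fin.snoc u x, fun P hP hFP hPu hPE => ?_⟩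
    have hJP : J ≤ P := by
      refine sup_le hFP (Ideal.span_le.mpr ?_)
      rintro _ ⟨k, rfl⟩
      have := hPu k.castSucc
      rwa [Fin.snoc_castSucc] at this
    obtain ⟨P0, hP0, hle⟩ := Ideal.exists_minimalPrimes_le hJP
    have hP0E : ∃ x, auxRι R E x ∉ P0 := by
      obtain ⟨y, hy⟩ := hPE
      exact ⟨y, fun h => hy (hle h)⟩
    have hp0 : P0.IsPrime := hP0.1.1
    have hF0 : fiberIdeal R E ≤ P0 := le_sup_left.trans hP0.1.2
    have h1 := hu P0 hp0 hF0 (fun k => hP0.1.2 (Ideal.mem_sup_right (Ideal.subset_span ⟨k, rfl⟩))) hP0E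
    have hxP : auxRι R E x ∈ P := by
      have := hPu (Fin.last i)
      rwa [Fin.snoc_last] at this
    have hlt : P0 < P := lt_of_le_not_ge hle fun h => hx (W P0) ⟨P0, ⟨hP0, hP0E⟩, rfl⟩ (h hxP)
    have h2 := aux_height_lt (fiberIdeal R E) P0 P hF0 hlt
    refine le_trans ?_ h2
    push_cast
    gcongr

theorem aux_exists_reduction (R : Type u) [CommRing R] [IsLocalRing R] [IsNoetherianRing R] [Infinite (IsLocalRing.ResidueField R)] 
    (E : Type u) [AddCommGroup E] [Module R E] [Module.Finite R E] (ℓ : ℕ) (hl : analyticSpread R E = (ℓ : WithBot ℕ∞)) : 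
    ∃ u : Fin ℓ → E, IsReduction R E (Submodule.span R (Set.range u)) := by
  obtain ⟨u, hu⟩ := aux_choose_u R E ℓ
  refine ⟨u, ?_⟩
  have hnoeth := aux_rees_noeth R E
  let J : Ideal (ReesModAlg R E) := fiberIdeal R E ⊔ Ideal.span (Set.range fun k => auxRι R E (u k))
  have hJγ : ∀ P : Ideal (ReesModAlg R E), J ≤ P → J ≤ (P.map C).comap (auxγ R E).toRingHom := by
    intro P hJP
    refine sup_le (Ideal.map_le_iff_le_comap.mpr fun r hr => ?_) (Ideal.span_le.mpr ?_)
    · change auxγ R E (algebraMap R _ r) ∈ P.map C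
      rw [AlgHom.commutes]
      exact Ideal.mem_map_of_mem _ (hJP (Ideal.mem_sup_left (Ideal.mem_map_of_mem _ hr)))
    · rintro _ ⟨k, rfl⟩
      change auxγ R E (auxRι R E (u k)) ∈ P.map C
      rw [auxγ_ι, ← C_mul_X_pow_eq_monomial]
      exact Ideal.mul_mem_right _ _ (Ideal.mem_map_of_mem _ (hJP (Ideal.mem_sup_right (Ideal.subset_span ⟨k, rfl⟩))))
  let 𝔐 : Ideal (ReesModAlg R E) := (IsLocalRing.maximalIdeal R).comap (auxε R E).toRingHom
  have hMp : 𝔐.IsPrime := Ideal.comap_isPrime _ _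
  have hmin : ∀ P ∈ J.minimalPrimes, ∀ x, auxRι R E x ∈ P := by
    intro P hP
    by_contra hcon
    push Not at hcon
    have hPp : P.IsPrime := hP.1.1
    have hFP : fiberIdeal R E ≤ P := le_sup_left.trans hP.1.2
    have h1 := hu P hPp hFP (fun k => hP.1.2 (Ideal.mem_sup_right (Ideal.subset_span ⟨k, rfl⟩))) hcon
    let P' := (P.map C).comap (auxγ R E).toRingHom
    have hPC : (P.map (C : ReesModAlg R E →+* (ReesModAlg R E)[X])).IsPrime := Ideal.isPrime_map_C_of_isPrime
    have hP' : P'.IsPrime := Ideal.comap_isPrime _ _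
    have hle : P' ≤ P := by
      intro f hf
      have h2 : auxγ R E f ∈ P.map C := hf
      have h3 : P.map C ≤ P.comap (evalRingHom 1) := by
        rw [Ideal.map_le_iff_le_comap]
        intro a ha
        change eval 1 (C a) ∈ P
        rwa [eval_C]
      have h4 : eval 1 (auxγ R E f) ∈ P := h3 h2
      rwa [auxγ_eval] at h4
    have hPP' : P ≤ P' := hP.2 ⟨hP', hJγ P hP.1.2⟩ hle
    have hPM : P ≤ 𝔐 := by
      intro f hf
      have h2 : auxγ R E f ∈ P.map C := hPP' hf
      have h3 := Ideal.mem_map_C_iff.mp h2 0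
      rw [auxγ_zero] at h3
      change auxε R E f ∈ IsLocalRing.maximalIdeal R
      by_contra h4
      have h5 : IsUnit (auxε R E f) := by simpa using h4
      exact hPp.ne_top (Ideal.eq_top_of_isUnit_mem _ h3 (h5.map _))
    have hlt : P < 𝔐 := by
      refine lt_of_le_not_ge hPM fun h => ?_
      obtain ⟨x, hx⟩ := hcon
      refine hx (h ?_)
      change auxε R E _ ∈ IsLocalRing.maximalIdeal R
      rw [auxε_ι]; exact zero_mem _
    have h6 := aux_height_lt _ P 𝔐 hFP hlt
    have hne : 𝔐.map (Ideal.Quotient.mk (fiberIdeal R E)) ≠ ⊤ := 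
      (Ideal.map_isPrime_of_surjective Ideal.Quotient.mk_surjective (by rw [Ideal.mk_ker]; exact hFP.trans hPM)).ne_top
    have h7 := Ideal.height_le_ringKrullDim_of_ne_top hne
    change _ ≤ analyticSpread R E at h7
    rw [hl] at h7
    have h8 : (𝔐.map (Ideal.Quotient.mk (fiberIdeal R E))).height ≤ (ℓ : ℕ∞) := by
      exact WithBot.coe_le_coe.mp h7
    have h9 : (ℓ : ℕ∞) + 1 ≤ ℓ := by
      refine le_trans ?_ (h6.trans h8)
      gcongr
    have h10 : ℓ + 1 ≤ ℓ := by exact_mod_cast h9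
    omega
  have hrad : Ideal.span (Set.range (auxRι R E)) ≤ J.radical := by
    rw [Ideal.span_le, ← Ideal.sInf_minimalPrimes]
    rintro _ ⟨x, rfl⟩
    exact Ideal.mem_sInf.mpr fun {P} hP => hmin P hP x
  obtain ⟨N, hN⟩ := Ideal.exists_pow_le_of_le_radical_of_fg hrad (IsNoetherian.noetherian _)
  refine ⟨N, le_antisymm ?_ ?_⟩
  swap
  · rw [aux_mulPower, aux_reesPower, aux_reesPower, pow_succ']
    exact mul_le_mul' LinearMap.map_le_range le_rfl
  have hfg : (reesPower R E (N + 1)).FG := by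
    rw [aux_reesPower]
    have h0 := Submodule.FG.map (auxRι R E) (Module.Finite.fg_top (R := R) (M := E))
    rw [Submodule.map_top] at h0
    exact h0.pow _
  refine Submodule.le_of_le_smul_of_le_jacobson_bot (I := IsLocalRing.maximalIdeal R) hfg (IsLocalRing.jacobson_eq_maximalIdeal _ bot_ne_top).ge ?_
  let cN : ReesModAlg R E →ₗ[R] ReesModAlg R E := 
    ((lcoeff (ReesModAlg R E) (N + 1)).restrictScalars R) ∘ₗ (auxγ R E).toLinearMap
  have hcN : ∀ a, cN a = (auxγ R E a).coeff (N + 1) := fun a => rfl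
  have hJ : ∀ a ∈ J, cN a ∈ mulPower R E (Submodule.span R (Set.range u)) N ⊔ IsLocalRing.maximalIdeal R • reesPower R E (N + 1) := by
    intro a ha
    obtain ⟨b, hb, c, hc, rfl⟩ := Submodule.mem_sup.mp ha
    rw [map_add]
    refine add_mem ?_ ?_
    · refine Submodule.mem_sup_right ?_
      have h1 : b ∈ (IsLocalRing.maximalIdeal R • ⊤ : Submodule R (ReesModAlg R E)) := by
        rw [Ideal.smul_top_eq_map]; exact hb
      have h2 := Submodule.mem_map_of_mem (f := cN) h1
      rw [Submodule.map_smul''] at h2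
      refine Submodule.smul_mono le_rfl ?_ h2
      rintro _ ⟨y, -, rfl⟩
      exact auxγ_coeff_mem R E y (N + 1)
    · refine Submodule.mem_sup_left ?_
      obtain ⟨f, rfl⟩ := (Ideal.mem_span_range_iff_exists_fun).mp hc
      rw [map_sum]
      refine sum_mem fun k _ => ?_
      rw [hcN, map_mul, auxγ_ι, coeff_mul_monomial, mul_comm, aux_mulPower]
      exact Submodule.mul_mem_mul ⟨_, Submodule.subset_span ⟨k, rfl⟩, rfl⟩ (auxγ_coeff_mem R E _ _)
  intro a ha
  have h1 : a ∈ J := by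
    have h3 : reesPower R E (N + 1) ≤ ((Ideal.span (Set.range (auxRι R E))) ^ (N + 1)).restrictScalars R := by
      rw [reesPower, Submodule.span_le]
      rintro _ ⟨f, rfl⟩
      have := Ideal.prod_mem_prod (s := Finset.univ) (I := fun _ : Fin (N + 1) => Ideal.span (Set.range (auxRι R E)))
        (x := fun i => reesι R E (f i)) (fun i _ => Ideal.subset_span ⟨f i, rfl⟩)
      rw [Finset.prod_const, Finset.card_univ, Fintype.card_fin] at this
      exact this
    exact hN (Ideal.pow_le_pow_right (Nat.le_succ N) (h3 ha))
  have h2 := hJ a h1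
  rwa [hcN, auxγ_power R E a _ ha, coeff_monomial_same] at h2

end

section
theorem aux_macaulay_R {R : Type u} [CommRing R] [IsNoetherianRing R] {N n : ℕ} (w : Fin N → Fin n → R) (p : Ideal R) [p.IsPrime]
    (y : Fin n → R) (hy : ∀ s, s ∉ p → s • y ∉ Submodule.span R (Set.range w)) 
    (hq : ∀ q : Ideal R, q.IsPrime → q < p → ∃ s, s ∉ q ∧ ∀ y : Fin n → R, s • y ∈ Submodule.span R (Set.range w)) :
    p.height ≤ ((N + 1 - n : ℕ) : ℕ∞) := by
  let A := Localization.AtPrime p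
  have hA : IsNoetherianRing A := IsLocalization.isNoetherianRing p.primeCompl A inferInstance
  let v : Fin N → Fin n → A := fun k i => algebraMap R A (w k i)
  have hmem : ∀ f : R, algebraMap R A f ∈ IsLocalRing.maximalIdeal A ↔ f ∈ p := fun f => 
    IsLocalization.AtPrime.to_map_mem_maximal_iff A p f
  have hht : (IsLocalRing.maximalIdeal A).height = p.height := by
    rw [← IsLocalization.height_under p.primeCompl, IsLocalization.AtPrime.under_maximalIdeal A p]
  have hup : ∀ w0 ∈ Submodule.span R (Set.range w), (fun i => algebraMap R A (w0 i)) ∈ Submodule.span A (Set.range v) := by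
    intro w0 hw0
    induction hw0 using Submodule.span_induction with
    | mem x hx => 
      obtain ⟨k, rfl⟩ := hx
      exact Submodule.subset_span ⟨k, rfl⟩
    | zero => 
      convert zero_mem (Submodule.span A (Set.range v)) using 1
      ext1 i; simp
    | add x y hx hy h1 h2 => 
      convert add_mem h1 h2 using 1
      ext1 i; simp
    | smul a x hx h1 => 
      convert Submodule.smul_mem _ (algebraMap R A a) h1 using 1
      ext1 i; simp
  have hdown : ∀ x ∈ Submodule.span A (Set.range v), ∃ s, s ∉ p ∧ ∃ w0 ∈ Submodule.span R (Set.range w), 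
      ∀ i, algebraMap R A s * x i = algebraMap R A (w0 i) := by
    intro x hx
    induction hx using Submodule.span_induction with
    | mem x hx => 
      obtain ⟨k, rfl⟩ := hx
      exact ⟨1, p.one_notMem, w k, Submodule.subset_span ⟨k, rfl⟩, fun i => by simp [v]⟩
    | zero => exact ⟨1, p.one_notMem, 0, zero_mem _, fun i => by simp⟩
    | add x y hx hy h1 h2 => 
      obtain ⟨s, hs, a, ha, h1⟩ := h1
      obtain ⟨t, ht, b, hb, h2⟩ := h2
      refine ⟨s * t, p.primeCompl.mul_mem hs ht, t • a + s • b, add_mem (Submodule.smul_mem _ _ ha) (Submodule.smul_mem _ _ hb), fun i => ?_⟩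
      simp only [Pi.add_apply, Pi.smul_apply, smul_eq_mul, map_add, map_mul, ← h1, ← h2]
      ring
    | smul c x hx h1 => 
      obtain ⟨s, hs, a, ha, h1⟩ := h1
      obtain ⟨⟨r, t⟩, hrt⟩ := IsLocalization.surj p.primeCompl c
      refine ⟨s * t, p.primeCompl.mul_mem hs t.2, r • a, Submodule.smul_mem _ _ ha, fun i => ?_⟩
      simp only at hrt
      simp only [Pi.smul_apply, smul_eq_mul, map_mul, ← h1, ← hrt]
      ring
  rw [← hht]
  refine aux_macaulay n A N v ?_ ?_
  · intro htop
    obtain ⟨s, hs, w0, hw0, h1⟩ := hdown (fun i => algebraMap R A (y i)) (by rw [htop]; trivial)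
    have h2 : ∀ i, ∃ t : p.primeCompl, (t : R) * (s * y i) = t * w0 i := by
      intro i
      have := h1 i
      rw [← map_mul] at this
      exact IsLocalization.exists_of_eq (M := p.primeCompl) this
    choose t ht using h2
    have h3 : ∀ i, (∏ i, (t i : R)) * (s * y i) = (∏ i, (t i : R)) * w0 i := by
      intro i
      rw [← Finset.mul_prod_erase Finset.univ _ (Finset.mem_univ i)]
      linear_combination (∏ x ∈ Finset.univ.erase i, (t x : R)) * ht i
    refine hy ((∏ i, (t i : R)) * s) (p.primeCompl.mul_mem (prod_mem fun i _ => (t i).2) hs) ?_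
    have h4 : ((∏ i, (t i : R)) * s) • y = (∏ i, (t i : R)) • w0 := by
      ext1 i
      simp only [Pi.smul_apply, smul_eq_mul]
      rw [← h3 i]; ring
    rw [h4]
    exact Submodule.smul_mem _ _ hw0
  · intro q hqp hqm
    have hle : q.comap (algebraMap R A) ≤ p := fun f hf => (hmem f).mp (hqm.le hf)
    have hlt : q.comap (algebraMap R A) < p := by
      refine lt_of_le_of_ne hle fun heq => hqm.ne ?_
      have e1 := IsLocalization.map_under p.primeCompl A q
      have e2 := IsLocalization.map_under p.primeCompl A (IsLocalRing.maximalIdeal A)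
      rw [← e1, ← e2]
      congr 1
      change q.comap (algebraMap R A) = (IsLocalRing.maximalIdeal A).comap (algebraMap R A)
      rw [heq]
      ext f
      exact (hmem f).symm
    obtain ⟨s, hs, hsw⟩ := hq _ (Ideal.comap_isPrime _ _) hlt
    refine ⟨algebraMap R A s, hs, fun x => ?_⟩
    have hw : x = ∑ i, x i • (Pi.single i 1 : Fin n → A) := by
      ext1 j
      simp [Finset.sum_apply, Pi.single_apply]
    rw [hw, Finset.smul_sum]
    refine sum_mem fun i _ => ?_
    rw [smul_comm]
    refine Submodule.smul_mem _ _ ?_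
    convert hup (s • Pi.single i 1) (hsw _) using 1
    ext1 j
    by_cases hij : j = i
    · subst hij; simp
    · simp [hij]

theorem aux_ht_one {R : Type u} [CommRing R] (q : Ideal R) [q.IsPrime] (h : ∃ a ∈ q, a ∈ nonZeroDivisors R) : 1 ≤ q.height := by
  rw [ENat.one_le_iff_ne_zero]
  intro h0
  rw [Ideal.height_eq_zero_iff] at h0
  obtain ⟨a, ha, hr⟩ := h
  exact Set.disjoint_left.mp (Ideal.disjoint_nonZeroDivisors_of_mem_minimalPrimes h0) ha hr

theorem aux_dim_eq {R : Type u} [CommRing R] (q : Ideal R) (hq : q.IsPrime) : localDimAt R q hq = (q.height : WithBot ℕ∞) :=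
  IsLocalization.AtPrime.ringKrullDim_eq_height q (Localization.AtPrime q)

theorem aux_hyp_G {R : Type u} [CommRing R] [IsNoetherianRing R] {E : Type u} [AddCommGroup E] [Module R E] [Module.Finite R E] 
    {n m e s : ℕ} (φ : (Fin m → R) →ₗ[R] Fin n → R) (ψ : (Fin n → R) →ₗ[R] E)
    (hψ : Function.Surjective ψ) (hφψ : LinearMap.range φ = LinearMap.ker ψ) (he : 0 < e) (hnme : n = m + e) 
    (hG : Gcond R E e s)
    (q : Ideal R) [hq : q.IsPrime] (h1 : ∃ a ∈ q, a ∈ nonZeroDivisors R) (h2 : q.height + 1 ≤ (s : ℕ∞)) : 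
    auxHyp R (fun j => φ (Pi.single j 1)) q := by
  refine aux_hyp_of φ ψ hψ hφψ he hnme q (hG q hq ?_ ?_)
  · rw [aux_dim_eq]
    exact WithBot.coe_le_coe.mpr (aux_ht_one q h1)
  · rw [aux_dim_eq]
    exact WithBot.coe_le_coe.mpr h2

theorem aux_tors_G {R : Type u} [CommRing R] [IsLocalRing R] [IsNoetherianRing R] (hCM : IsCMLocalRing R) 
    {E : Type u} [AddCommGroup E] [Module R E] [Module.Finite R E] 
    {n m e s : ℕ} (φ : (Fin m → R) →ₗ[R] Fin n → R) (ψ : (Fin n → R) →ₗ[R] E) (hφ : Function.Injective φ)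
    (hψ : Function.Surjective ψ) (hφψ : LinearMap.range φ = LinearMap.ker ψ) (he : 0 < e) (hrank : HasRank R E e)
    (hG : Gcond R E e s) (K : Finset (Fin m))
    (p : Ideal R) [hp : p.IsPrime] (h2 : p.height + 1 ≤ (s : ℕ∞)) (z : MvPolynomial (Fin n) R) (a : R) 
    (ha : a ∈ nonZeroDivisors R) (haz : MvPolynomial.C a * z ∈ auxI R (fun j => φ (Pi.single j 1)) K) :
    ∃ s ∉ p, MvPolynomial.C s * z ∈ auxI R (fun j => φ (Pi.single j 1)) K := by
  obtain ⟨hnme, hgen⟩ := aux_generic hrank φ ψ hφ hψ hφψ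
  refine aux_T hCM _ hgen K p (fun q hq hqp hqa => aux_hyp_G φ ψ hψ hφψ he hnme hG q hqa (le_trans ?_ h2)) z a ha haz
  gcongr

theorem aux_red_G {R : Type u} [CommRing R] [IsLocalRing R] [IsNoetherianRing R] (hCM : IsCMLocalRing R) 
    {E : Type u} [AddCommGroup E] [Module R E] [Module.Finite R E] 
    {n m e s : ℕ} (φ : (Fin m → R) →ₗ[R] Fin n → R) (ψ : (Fin n → R) →ₗ[R] E) (hφ : Function.Injective φ)
    (hψ : Function.Surjective ψ) (hφψ : LinearMap.range φ = LinearMap.ker ψ) (he : 0 < e) (hrank : HasRank R E e)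
    (hG : Gcond R E e s) (U : Submodule R E) (hU : IsReduction R E U)
    (p : Ideal R) [hp : p.IsPrime] (h2 : p.height + 1 ≤ (s : ℕ∞)) : 
    (⟨p, hp⟩ : PrimeSpectrum R) ∉ Module.support R (E ⧸ U) := by
  refine aux_lemma_L _ (aux_sym_torsion φ ψ hψ hφψ p fun z a ha haz => ?_) U hU
  exact aux_tors_G hCM φ ψ hφ hψ hφψ he hrank hG _ p h2 z a ha haz

theorem aux_part1 {R : Type u} [CommRing R] [IsLocalRing R] [IsNoetherianRing R] (hCM : IsCMLocalRing R) 
    {E : Type u} [AddCommGroup E] [Module R E] [Module.Finite R E] 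
    {n m e ℓ : ℕ} (φ : (Fin m → R) →ₗ[R] Fin n → R) (ψ : (Fin n → R) →ₗ[R] E) (hφ : Function.Injective φ)
    (hψ : Function.Surjective ψ) (hφψ : LinearMap.range φ = LinearMap.ker ψ) (he : 0 < e) (hrank : HasRank R E e)
    (hG : Gcond R E e (ℓ - e + 2)) (u : Fin ℓ → E) (hU : IsReduction R E (Submodule.span R (Set.range u))) :
    Submodule.span R (Set.range u) = ⊤ := by
  obtain ⟨hnme, -⟩ := aux_generic hrank φ ψ hφ hψ hφψ
  set U := Submodule.span R (Set.range u) with hUdef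
  by_contra hne
  have hnt : Nontrivial (E ⧸ U) := Submodule.Quotient.nontrivial_iff.mpr hne
  have hann : Module.annihilator R (E ⧸ U) ≠ ⊤ := by
    rw [Ne, Module.annihilator_eq_top_iff]
    exact not_subsingleton _
  obtain ⟨p, hp⟩ := Ideal.nonempty_minimalPrimes hann
  have hpp : p.IsPrime := hp.1.1
  have hps : (⟨p, hpp⟩ : PrimeSpectrum R) ∈ Module.support R (E ⧸ U) := Module.mem_support_iff_of_finite.mpr hp.1.2
  choose g hg using fun k => hψ (u k)
  let w : Fin (m + ℓ) → Fin n → R := Fin.append (fun j => φ (Pi.single j 1)) g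
  have hW : Submodule.span R (Set.range w) = U.comap ψ := by
    have e1 : U.comap ψ = LinearMap.ker ψ ⊔ Submodule.span R (Set.range g) := by
      have : U = (Submodule.span R (Set.range g)).map ψ := by
        rw [Submodule.map_span, hUdef, ← Set.range_comp]
        congr 2
        ext1 k; exact (hg k).symm
      rw [this, Submodule.comap_map_eq, sup_comm]
    have e2 : LinearMap.ker ψ = Submodule.span R (Set.range fun j => φ (Pi.single j 1)) := by
      rw [← hφψ, LinearMap.range_eq_map, ← (Pi.basisFun R (Fin m)).span_eq, Submodule.map_span, ← Set.range_comp]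
      congr 2
      ext1 k; simp
    rw [e1, e2, ← Submodule.span_union]
    congr 1
    ext x
    constructor
    · rintro ⟨k, rfl⟩
      refine Fin.addCases (fun j => ?_) (fun j => ?_) k
      · exact Or.inl ⟨j, by simp [w]⟩
      · exact Or.inr ⟨j, by simp [w]⟩
    · rintro (⟨j, rfl⟩ | ⟨j, rfl⟩)
      · exact ⟨Fin.castAdd ℓ j, by simp [w]⟩
      · exact ⟨Fin.natAdd m j, by simp [w]⟩
  have hWmem : ∀ (s : R) (y : Fin n → R), s • y ∈ Submodule.span R (Set.range w) ↔ s • (Submodule.Quotient.mk (ψ y) : E ⧸ U) = 0 := by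
    intro s y
    rw [hW, Submodule.mem_comap, map_smul, ← Submodule.Quotient.mk_smul, Submodule.Quotient.mk_eq_zero]
  obtain ⟨y, hy⟩ := Module.mem_support_iff'.mp hps
  obtain ⟨y, rfl⟩ := Submodule.Quotient.mk_surjective _ y
  obtain ⟨y, rfl⟩ := hψ y
  have hM := aux_macaulay_R w p y (fun s hs h => hy s hs ((hWmem s y).mp h)) (by
    intro q hq hqp
    have h1 : ¬ Module.annihilator R (E ⧸ U) ≤ q := fun h => hqp.not_ge (hp.2 ⟨hq, h⟩ hqp.le)
    obtain ⟨s, hs, hsq⟩ := SetLike.not_le_iff_exists.mp h1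
    exact ⟨s, hsq, fun y => (hWmem s y).mpr (Module.mem_annihilator.mp hs _)⟩)
  refine aux_red_G hCM φ ψ hφ hψ hφψ he hrank hG U hU p ?_ hps
  have h3 : ((m + ℓ + 1 - n : ℕ) : ℕ∞) + 1 ≤ ((ℓ - e + 2 : ℕ) : ℕ∞) := by
    have : (m + ℓ + 1 - n) + 1 ≤ ℓ - e + 2 := by omega
    exact_mod_cast this
  refine le_trans ?_ h3
  gcongr

theorem aux_minGens_le {R : Type u} [CommRing R] {E : Type u} [AddCommGroup E] [Module R E] {N : ℕ} (f : Fin N → E)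
    (h : Submodule.span R (Set.range f) = ⊤) : minGens R E ≤ N := Nat.sInf_le ⟨f, h⟩

theorem aux_minGens_loc {R : Type u} [CommRing R] {E : Type u} [AddCommGroup E] [Module R E] [Module.Finite R E] (p : Ideal R) (hp : p.IsPrime) :
    minGens (Localization (primeCompl' R p hp)) (LocalizedModule (primeCompl' R p hp) E) ≤ minGens R E := by
  obtain ⟨f, hf⟩ := aux_minGens_spec (R := R) E
  refine aux_minGens_le (fun i => LocalizedModule.mkLinearMap (primeCompl' R p hp) E (f i)) ?_
  have := span_eq_top_of_isLocalizedModule (Localization (primeCompl' R p hp)) (primeCompl' R p hp) (LocalizedModule.mkLinearMap (primeCompl' R p hp) E) hf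
  rwa [← Set.range_comp] at this

theorem aux_part2 {R : Type u} [CommRing R] 
    {E : Type u} [AddCommGroup E] [Module R E] [Module.Finite R E] 
    {e ℓ : ℕ} (he : 0 < e) (hmin : minGens R E ≤ ℓ)
    (hG : Gcond R E e (ℓ - e + 2)) : GcondInf R E e := by
  intro s p hp h1 h2
  by_cases h : localDimAt R p hp + 1 ≤ ((ℓ - e + 2 : ℕ) : WithBot ℕ∞)
  · exact hG p hp h1 h
  · have h3 := (aux_minGens_loc (E := E) p hp).trans hmin
    rw [aux_dim_eq] at h ⊢
    set d := p.height
    by_cases hd : d = ⊤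
    · rw [hd]
      change (WithBot.some (minGens _ _ : ℕ∞)) ≤ WithBot.some ((⊤ : ℕ∞) + ((e - 1 : ℕ) : ℕ∞))
      rw [top_add]
      exact WithBot.coe_le_coe.mpr le_top
    · obtain ⟨k, hk⟩ := ENat.ne_top_iff_exists.mp hd
      rw [← hk] at h ⊢
      have h' : ¬ (k + 1 ≤ ℓ - e + 2) := fun hh => h (by
        change WithBot.some ((k : ℕ∞) + 1) ≤ WithBot.some ((ℓ - e + 2 : ℕ) : ℕ∞)
        exact WithBot.coe_le_coe.mpr (by exact_mod_cast hh))
      change (WithBot.some (minGens _ _ : ℕ∞)) ≤ WithBot.some ((k : ℕ∞) + ((e - 1 : ℕ) : ℕ∞))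
      refine WithBot.coe_le_coe.mpr ?_
      have : minGens (Localization (primeCompl' R p hp)) (LocalizedModule (primeCompl' R p hp) E) ≤ k + (e - 1) := by omega
      exact_mod_cast this

end

section
open MvPolynomial CategoryTheory

theorem aux_extVanish_of_pd {R : Type u} [CommRing R] (M N : Type u) [AddCommGroup M] [Module R M] [AddCommGroup N] [Module R N]
    (k : ℕ) (h : HasProjectiveDimensionLT (ModuleCat.of R M) (k + 1)) : extVanish R M N (k + 1) := by
  let P : ProjectiveResolution (ModuleCat.of R M) := projectiveResolution _
  have hz : Limits.IsZero (((Ext R (ModuleCat.{u} R) (k + 1)).obj (Opposite.op (ModuleCat.of R M))).obj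
      (ModuleCat.of R N)) := by
    refine Limits.IsZero.of_iso ?_ (P.isoExt (R := R) (k + 1) (ModuleCat.of R N))
    rw [← HomologicalComplex.exactAt_iff_isZero_homology, 
      HomologicalComplex.exactAt_iff' _ k (k + 1) (k + 2) (by simp) (by simp)]
    rw [ShortComplex.moduleCat_exact_iff]
    intro (f : P.complex.X (k + 1) ⟶ ModuleCat.of R N) hf
    have hf' : P.complex.d (k + 2) (k + 1) ≫ f = 0 := hf
    have h0 := (P.extMk_eq_zero_iff f (k + 2) rfl hf' k rfl).mp 
      (Abelian.Ext.eq_zero_of_hasProjectiveDimensionLT _ (k + 1) le_rfl)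
    obtain ⟨g, hg⟩ := h0
    exact ⟨g, hg⟩
  exact ModuleCat.subsingleton_of_isZero hz

theorem auxLf_hom {R : Type u} [CommRing R] {n : ℕ} (w : Fin n → R) : (auxLf R n w).IsHomogeneous 1 := by
  rw [auxLf_apply]
  refine IsHomogeneous.sum _ _ _ fun i _ => ?_
  simpa using (isHomogeneous_C (Fin n) (w i)).mul (isHomogeneous_X R i)

theorem aux_comp_mul {R : Type u} [CommRing R] {n : ℕ} (l : MvPolynomial (Fin n) R) (hl : l.IsHomogeneous 1) (j : ℕ) 
    (a : MvPolynomial (Fin n) R) : homogeneousComponent (j + 1) (l * a) = l * homogeneousComponent j a := by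
  induction a using MvPolynomial.induction_on' with
  | add p q hp hq => rw [mul_add, map_add, hp, hq, map_add, mul_add]
  | monomial d r => 
    have h1 : (monomial d r : MvPolynomial (Fin n) R).IsHomogeneous d.degree := isHomogeneous_monomial r rfl
    rw [homogeneousComponent_of_mem h1, homogeneousComponent_of_mem (hl.mul h1)]
    by_cases h : d.degree = j
    · rw [if_pos (by omega), if_pos h.symm]
    · rw [if_neg (by omega), if_neg (Ne.symm h), mul_zero]

theorem aux_comp_mul_zero {R : Type u} [CommRing R] {n : ℕ} (l : MvPolynomial (Fin n) R) (hl : l.IsHomogeneous 1) 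
    (a : MvPolynomial (Fin n) R) : homogeneousComponent 0 (l * a) = 0 := by
  induction a using MvPolynomial.induction_on' with
  | add p q hp hq => rw [mul_add, map_add, hp, hq, add_zero]
  | monomial d r => 
    have h1 : (monomial d r : MvPolynomial (Fin n) R).IsHomogeneous d.degree := isHomogeneous_monomial r rfl
    rw [homogeneousComponent_of_mem (hl.mul h1), if_neg (by omega)]

theorem auxI_empty {R : Type u} [CommRing R] {n m : ℕ} (v : Fin m → Fin n → R) : auxI R v ∅ = ⊥ := by
  simp [auxI]

theorem auxI_comp {R : Type u} [CommRing R] {n m : ℕ} (v : Fin m → Fin n → R) (K : Finset (Fin m)) (j : ℕ) :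
    ∀ f ∈ auxI R v K, homogeneousComponent j f ∈ auxI R v K := by
  induction K using Finset.induction_on with
  | empty => 
    intro f hf
    rw [auxI_empty, Ideal.mem_bot] at hf
    rw [hf, map_zero]
    exact zero_mem _
  | insert l K hl ih => 
    intro f hf
    rw [auxI_insert] at hf ⊢
    obtain ⟨a, ha⟩ := hf
    have h := ih _ ha
    rw [map_sub] at h
    cases j with
    | zero => 
      rw [aux_comp_mul_zero _ (auxLf_hom _)] at h
      exact ⟨0, by simpa using h⟩
    | succ j => 
      rw [aux_comp_mul _ (auxLf_hom _)] at h
      exact ⟨_, h⟩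

theorem auxI_zero {R : Type u} [CommRing R] {n m : ℕ} (v : Fin m → Fin n → R) (K : Finset (Fin m)) :
    ∀ f ∈ auxI R v K, homogeneousComponent 0 f = 0 := by
  induction K using Finset.induction_on with
  | empty => 
    intro f hf
    rw [auxI_empty, Ideal.mem_bot] at hf
    rw [hf, map_zero]
  | insert l K hl ih => 
    intro f hf
    rw [auxI_insert] at hf
    obtain ⟨a, ha⟩ := hf
    have h := ih _ ha
    rwa [map_sub, aux_comp_mul_zero _ (auxLf_hom _), sub_zero] at h

/-- The part of the ideal in degree `j`. -/
def auxJ (R : Type u) [CommRing R] {n m : ℕ} (v : Fin m → Fin n → R) (K : Finset (Fin m)) (j : ℕ) : 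
    Submodule R (homogeneousSubmodule (Fin n) R j) :=
  ((auxI R v K).restrictScalars R).comap (homogeneousSubmodule (Fin n) R j).subtype

theorem aux_mem_J {R : Type u} [CommRing R] {n m : ℕ} (v : Fin m → Fin n → R) (K : Finset (Fin m)) (j : ℕ) (x) :
    x ∈ auxJ R v K j ↔ (x : MvPolynomial (Fin n) R) ∈ auxI R v K := Iff.rfl

theorem aux_H_proj (R : Type u) [CommRing R] (n j : ℕ) : Module.Projective R (homogeneousSubmodule (Fin n) R j) := by
  refine Module.Projective.of_split (homogeneousSubmodule (Fin n) R j).subtype 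
    ((homogeneousComponent j).codRestrict _ (homogeneousComponent_mem j)) ?_
  ext x : 2
  exact homogeneousComponent_eq_self x.2

theorem aux_N_proj {R : Type u} [CommRing R] {n m : ℕ} (v : Fin m → Fin n → R) (K : Finset (Fin m)) (j : ℕ) 
    (h : auxJ R v K j = ⊥) : Module.Projective R (homogeneousSubmodule (Fin n) R j ⧸ auxJ R v K j) := by
  have := aux_H_proj R n j
  exact Module.Projective.of_equiv (Submodule.quotEquivOfEqBot _ h).symm

theorem aux_N_ses {R : Type u} [CommRing R] {n m : ℕ} (v : Fin m → Fin n → R) (K : Finset (Fin m)) (l : Fin m) (j k : ℕ)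
    (hreg : ∀ z, auxLf R n (v l) * z ∈ auxI R v K → z ∈ auxI R v K) 
    (h1 : HasProjectiveDimensionLT (ModuleCat.of R (homogeneousSubmodule (Fin n) R j ⧸ auxJ R v K j)) k)
    (h2 : HasProjectiveDimensionLT (ModuleCat.of R (homogeneousSubmodule (Fin n) R (j+1) ⧸ auxJ R v K (j+1))) (k+1)) :
    HasProjectiveDimensionLT (ModuleCat.of R (homogeneousSubmodule (Fin n) R (j+1) ⧸ auxJ R v (insert l K) (j+1))) (k+1) := by
  let f0 : homogeneousSubmodule (Fin n) R j →ₗ[R] homogeneousSubmodule (Fin n) R (j+1) := 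
    (LinearMap.mulLeft R (auxLf R n (v l))).restrict (fun x hx => by
      have := (auxLf_hom (v l)).mul hx
      rwa [add_comm 1 j] at this)
  have hf0 : ∀ x, (f0 x : MvPolynomial (Fin n) R) = auxLf R n (v l) * x := fun x => rfl
  let f := Submodule.mapQ (auxJ R v K j) (auxJ R v K (j+1)) f0 
    (fun x hx => Ideal.mul_mem_left (auxI R v K) (auxLf R n (v l)) ((aux_mem_J v K j x).mp hx))
  let g := Submodule.factor (p := auxJ R v K (j+1)) (p' := auxJ R v (insert l K) (j+1))
    (fun x hx => auxI_mono v (Finset.subset_insert l K) hx)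
  have hfg : g ∘ₗ f = 0 := by
    refine LinearMap.ext fun x => ?_
    obtain ⟨x, rfl⟩ := Submodule.mkQ_surjective _ x
    change (Submodule.mkQ _ (f0 x)) = 0
    rw [Submodule.mkQ_apply, Submodule.Quotient.mk_eq_zero, aux_mem_J, hf0]
    exact (auxI_insert v K l _).mpr ⟨x, by simp⟩
  let S : ShortComplex (ModuleCat.{u} R) := ShortComplex.mk (ModuleCat.ofHom f) (ModuleCat.ofHom g)
    (by rw [← ModuleCat.ofHom_comp, hfg]; rfl)
  have hS : S.ShortExact := by
    have hm : Mono S.f := by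
      rw [ModuleCat.mono_iff_injective]
      change Function.Injective f
      rw [injective_iff_map_eq_zero]
      intro x hx
      obtain ⟨x, rfl⟩ := Submodule.mkQ_surjective _ x
      change (Submodule.mkQ _ (f0 x)) = 0 at hx
      rw [Submodule.mkQ_apply, Submodule.Quotient.mk_eq_zero, aux_mem_J, hf0] at hx
      rw [Submodule.mkQ_apply, Submodule.Quotient.mk_eq_zero, aux_mem_J]
      exact hreg _ hx
    have he : Epi S.g := by
      rw [ModuleCat.epi_iff_surjective]
      change Function.Surjective g
      intro x
      obtain ⟨x, rfl⟩ := Submodule.mkQ_surjective _ x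
      exact ⟨Submodule.mkQ _ x, rfl⟩
    refine ShortComplex.ShortExact.mk (S := S) ?_
    rw [ShortComplex.moduleCat_exact_iff]
    intro x hx
    change ∃ y, f y = x
    change g x = 0 at hx
    obtain ⟨x, rfl⟩ := Submodule.mkQ_surjective _ x
    change (Submodule.mkQ _ x) = 0 at hx
    rw [Submodule.mkQ_apply, Submodule.Quotient.mk_eq_zero, aux_mem_J, auxI_insert] at hx
    obtain ⟨a, ha⟩ := hx
    have h := auxI_comp v K (j+1) _ ha
    rw [map_sub, aux_comp_mul _ (auxLf_hom _), homogeneousComponent_eq_self x.2] at h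
    refine ⟨Submodule.mkQ _ ⟨homogeneousComponent j a, homogeneousComponent_mem j a⟩, ?_⟩
    change Submodule.mkQ _ (f0 _) = _
    rw [Submodule.mkQ_apply, Submodule.mkQ_apply, eq_comm, Submodule.Quotient.eq, aux_mem_J]
    exact h
  exact hS.hasProjectiveDimensionLT_X₃ k h1 h2

theorem aux_N_pd {R : Type u} [CommRing R] {n m : ℕ} (v : Fin m → Fin n → R) 
    (hreg : ∀ K l, l ∉ K → ∀ z, auxLf R n (v l) * z ∈ auxI R v K → z ∈ auxI R v K) (K : Finset (Fin m)) : ∀ j, 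
    HasProjectiveDimensionLT (ModuleCat.of R (homogeneousSubmodule (Fin n) R j ⧸ auxJ R v K j)) (j+1) := by
  have hP : ∀ (K : Finset (Fin m)) (j : ℕ), auxJ R v K j = ⊥ → 
      HasProjectiveDimensionLT (ModuleCat.of R (homogeneousSubmodule (Fin n) R j ⧸ auxJ R v K j)) (j+1) := by
    intro K j h
    have := aux_N_proj v K j h
    have h2 : Projective (ModuleCat.of R (homogeneousSubmodule (Fin n) R j ⧸ auxJ R v K j)) := 
      (IsProjective.iff_projective _).mp this
    rw [projective_iff_hasProjectiveDimensionLT_one] at h2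
    exact hasProjectiveDimensionLT_of_ge _ 1 _ (by omega)
  induction K using Finset.induction_on with
  | empty => 
    intro j
    refine hP _ _ (eq_bot_iff.mpr fun x hx => ?_)
    rw [aux_mem_J, auxI_empty, Ideal.mem_bot] at hx
    exact Subtype.ext hx
  | insert l K hl ih => 
    intro j
    cases j with
    | zero => 
      refine hP _ _ (eq_bot_iff.mpr fun x hx => ?_)
      have := auxI_zero v _ _ hx
      rw [Submodule.subtype_apply, homogeneousComponent_eq_self x.2] at this
      exact Subtype.ext this
    | succ j => exact aux_N_ses v K l j (j+1) (hreg K l hl) (ih j) (ih (j+1))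

theorem aux_rees_pow {R : Type u} [CommRing R] {E : Type u} [AddCommGroup E] [Module R E] {n m : ℕ}
    (φ : (Fin m → R) →ₗ[R] (Fin n → R)) (ψ : (Fin n → R) →ₗ[R] E)
    (hψ : Function.Surjective ψ) (hφψ : LinearMap.range φ = LinearMap.ker ψ)
    (hT : ∀ y ∈ torsionIdeal R (SymModAlg R E), y = 0) (j : ℕ) : 
    Nonempty ((homogeneousSubmodule (Fin n) R j ⧸ auxJ R (fun j => φ (Pi.single j 1)) Finset.univ j) ≃ₗ[R] 
      reesPower R E j) := by
  obtain ⟨Θ, hΘ⟩ := aux_sym_equiv φ ψ hψ hφψ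
  let g : Fin n → E := fun i => ψ (Pi.single i 1)
  let Φ : MvPolynomial (Fin n) R →ₐ[R] ReesModAlg R E := 
    (Ideal.Quotient.mkₐ R _).comp (Θ.symm.toAlgHom.comp (Ideal.Quotient.mkₐ R _))
  have hΦX : ∀ i, Φ (X i) = auxRι R E (g i) := by
    intro i
    have h := hΘ (Pi.single i 1)
    rw [auxLf_single] at h
    change Ideal.Quotient.mk _ (Θ.symm (Ideal.Quotient.mk _ (X i))) = _
    rw [← h, AlgEquiv.symm_apply_apply]
    rfl
  have hker : ∀ p, Φ p = 0 ↔ p ∈ auxI R (fun j => φ (Pi.single j 1)) Finset.univ := by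
    intro p
    change Ideal.Quotient.mk _ (Θ.symm (Ideal.Quotient.mk _ p)) = 0 ↔ _
    rw [Ideal.Quotient.eq_zero_iff_mem]
    constructor
    · intro h
      have := hT _ h
      rwa [EmbeddingLike.map_eq_zero_iff, Ideal.Quotient.eq_zero_iff_mem] at this
    · intro h
      rw [Ideal.Quotient.eq_zero_iff_mem.mpr h, map_zero]
      exact zero_mem _
  have hrange : (homogeneousSubmodule (Fin n) R j).map Φ.toLinearMap = reesPower R E j := by
    rw [← homogeneousSubmodule_one_pow, Submodule.map_pow, aux_reesPower]
    congr 1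
    rw [homogeneousSubmodule_one_eq_span_X, Submodule.map_span, ← Set.range_comp]
    have h1 : Submodule.span R (Set.range g) = ⊤ := by
      have : Set.range g = ψ '' Set.range (fun i => Pi.single i (1 : R)) := by
        rw [← Set.range_comp]; rfl
      rw [this, ← Submodule.map_span]
      have h2 := (Pi.basisFun R (Fin n)).span_eq
      have h3 : Set.range (Pi.basisFun R (Fin n)) = Set.range (fun i => Pi.single i (1 : R)) := by
        congr 1; ext i : 1; simp
      rw [h3] at h2
      rw [h2, Submodule.map_top, LinearMap.range_eq_top.mpr hψ]
    rw [LinearMap.range_eq_map, ← h1, Submodule.map_span, ← Set.range_comp]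
    congr 2
    ext i : 1
    exact hΦX i
  let F : homogeneousSubmodule (Fin n) R j →ₗ[R] ReesModAlg R E := Φ.toLinearMap ∘ₗ Submodule.subtype _
  have hFk : LinearMap.ker F = auxJ R (fun j => φ (Pi.single j 1)) Finset.univ j := by
    ext x
    rw [LinearMap.mem_ker, aux_mem_J, ← hker]
    rfl
  have hFr : LinearMap.range F = reesPower R E j := by
    rw [← hrange, LinearMap.range_comp, Submodule.range_subtype]
  exact ⟨(Submodule.quotEquivOfEq _ _ hFk.symm).trans (F.quotKerEquivRange.trans (LinearEquiv.ofEq _ _ hFr))⟩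

theorem aux_part3 {R : Type u} [CommRing R] [IsLocalRing R] [IsNoetherianRing R] (hCM : IsCMLocalRing R) 
    {E : Type u} [AddCommGroup E] [Module R E] [Module.Finite R E] 
    {n m e : ℕ} (φ : (Fin m → R) →ₗ[R] Fin n → R) (ψ : (Fin n → R) →ₗ[R] E) (hφ : Function.Injective φ)
    (hψ : Function.Surjective ψ) (hφψ : LinearMap.range φ = LinearMap.ker ψ) (he : 0 < e) (hrank : HasRank R E e)
    (hG : GcondInf R E e) : (∀ U : Submodule R E, IsReduction R E U → U = ⊤) ∧ 
    ∀ j, extVanish R (reesPower R E j) R (j + 1) := by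
  obtain ⟨hnme, hgen⟩ := aux_generic hrank φ ψ hφ hψ hφψ
  obtain ⟨d, hd⟩ := ENat.ne_top_iff_exists.mp (Ideal.height_ne_top (I := IsLocalRing.maximalIdeal R) 
    (Ideal.IsPrime.ne_top inferInstance))
  have h2 : (IsLocalRing.maximalIdeal R).height + 1 ≤ ((d + 1 : ℕ) : ℕ∞) := by
    rw [← hd]; norm_cast
  constructor
  · intro U hU
    by_contra hne
    have hnt : Nontrivial (E ⧸ U) := Submodule.Quotient.nontrivial_iff.mpr hne
    exact aux_red_G hCM φ ψ hφ hψ hφψ he hrank (hG (d+1)) U hU (IsLocalRing.maximalIdeal R) h2 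
      (IsLocalRing.closedPoint_mem_support R (E ⧸ U))
  · have hu : ∀ s : R, s ∉ IsLocalRing.maximalIdeal R → IsUnit s := fun s hs => by
      simpa using hs
    have hreg : ∀ K l, l ∉ K → ∀ z, auxLf R n (φ (Pi.single l 1)) * z ∈ auxI R (fun j => φ (Pi.single j 1)) K → 
        z ∈ auxI R (fun j => φ (Pi.single j 1)) K := by
      intro K l hl z hz
      obtain ⟨c, hc, hcz⟩ := aux_generic_regular _ hgen K l hl z hz
      obtain ⟨s, hs, hsz⟩ := aux_tors_G hCM φ ψ hφ hψ hφψ he hrank (hG (d+1)) K _ h2 z c hc hcz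
      exact (Ideal.unit_mul_mem_iff_mem _ ((hu s hs).map C)).mp hsz
    have hT : ∀ y ∈ torsionIdeal R (SymModAlg R E), y = 0 := by
      intro y hy
      obtain ⟨s, hs, hsy⟩ := aux_sym_torsion φ ψ hψ hφψ (IsLocalRing.maximalIdeal R) (fun z a ha haz => 
        aux_tors_G hCM φ ψ hφ hψ hφψ he hrank (hG (d+1)) _ _ h2 z a ha haz) y hy
      exact (hu s hs).smul_eq_zero.mp hsy
    intro j
    obtain ⟨Λ⟩ := aux_rees_pow φ ψ hψ hφψ hT j
    refine aux_extVanish_of_pd _ _ j ?_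
    have := aux_N_pd (fun j => φ (Pi.single j 1)) hreg Finset.univ j
    exact hasProjectiveDimensionLT_of_iso Λ.toModuleIso _

end

/-- A torsion-free module of rank `e > 0`, projective dimension one and
analytic spread `ℓ`, satisfying `G_{ℓ-e+2}` over a Cohen-Macaulay local ring with infinite
residue field, has no proper reductions (so `μ(E) = ℓ`), satisfies `G_∞`, and
`Ext^{j+1}(E^j, R) = 0` for all `j ≥ 1`. -/
theorem statement_7 (R : Type u) [CommRing R] [IsLocalRing R] [IsNoetherianRing R]
    [Infinite (IsLocalRing.ResidueField R)] (hCM : IsCMLocalRing R)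
    (E : Type u) [AddCommGroup E] [Module R E] [Module.Finite R E]
    (htf : Submodule.torsion R E = ⊥)
    (e ℓ : ℕ) (he : 0 < e) (hrank : HasRank R E e)
    (hl : analyticSpread R E = (ℓ : WithBot ℕ∞))
    (hpd1 : ∃ (n m : ℕ) (φ : (Fin m → R) →ₗ[R] (Fin n → R)) (ψ : (Fin n → R) →ₗ[R] E),
      Function.Injective φ ∧ Function.Surjective ψ ∧ LinearMap.range φ = LinearMap.ker ψ)
    (hpd0 : ¬ Module.Projective R E)
    (hG : Gcond R E e (ℓ - e + 2)) :
    (∀ U : Submodule R E, IsReduction R E U → U = ⊤) ∧ minGens R E = ℓ ∧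
      GcondInf R E e ∧
      ∀ j : ℕ, 1 ≤ j → extVanish R ↥(reesPower R E j) R (j + 1) := by
  obtain ⟨n, m, φ, ψ, hφ, hψ, hφψ⟩ := hpd1
  obtain ⟨u, hu⟩ := aux_exists_reduction R E ℓ hl
  have h1 := aux_part1 hCM φ ψ hφ hψ hφψ he hrank hG u hu
  have hmin : minGens R E ≤ ℓ := aux_minGens_le u h1
  have hge : ℓ ≤ minGens R E := by
    have := aux_spread_le R E
    rw [hl] at this
    exact_mod_cast this
  have hI := aux_part2 he hmin hG
  obtain ⟨ha, hb⟩ := aux_part3 hCM φ ψ hφ hψ hφψ he hrank hI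
  exact ⟨ha, le_antisymm hmin hge, hI, fun j _ => hb j⟩
end
end

section
/- Let R be a Noetherian local ring, U ⊆ E finitely generated R-modules with E of rank e, such that U is generated by ℓ elements and E_p = U_p for all primes p with dim R_p ≤ ℓ − e + 1. Assume moreover that E/U ≠ 0 would force ht(F_0(E/U)) ≤ ℓ − e + 1 by the Eagon-Northcott bound since E/U is generated by μ(E) − ℓ elements. Then in fact E = U. -/
open scoped TensorProduct

noncomputable section

universe u

/-- The zeroth Fitting ideal annihilates the module. -/
theorem fitting0_le_annihilator (R : Type u) [CommRing R] (M : Type u) [AddCommGroup M]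
    [Module R M] : fitting0 R M ≤ Module.annihilator R M := by
  unfold fitting0
  refine iSup_le fun n => iSup_le fun π => iSup_le fun hπ => Ideal.span_le.2 ?_
  rintro d ⟨A, hA, rfl⟩
  rw [SetLike.mem_coe, Module.mem_annihilator]
  intro m
  obtain ⟨v, rfl⟩ := hπ m
  have h1 : A.det • v = ∑ j, (A.adjugate.mulVec v) j • (fun i => A i j) := by
    have h2 : A.mulVec (A.adjugate.mulVec v) = A.det • v := by
      rw [Matrix.mulVec_mulVec, Matrix.mul_adjugate, Matrix.smul_mulVec, Matrix.one_mulVec]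
    rw [← h2]
    ext i
    simp [Matrix.mulVec, dotProduct, Finset.sum_apply, mul_comm]
  rw [← map_smul, h1, map_sum]
  refine Finset.sum_eq_zero fun j _ => ?_
  rw [map_smul, hA, smul_zero]

/-- A power of each annihilator element lies in the zeroth Fitting ideal. -/
theorem pow_mem_fitting0 (R : Type u) [CommRing R] (M : Type u) [AddCommGroup M]
    [Module R M] [Module.Finite R M] (s : R) (hs : s ∈ Module.annihilator R M) :
    ∃ n : ℕ, s ^ n ∈ fitting0 R M := by
  obtain ⟨n, π, hπ⟩ := Module.Finite.exists_fin' R M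
  refine ⟨n, ?_⟩
  unfold fitting0
  refine Submodule.mem_iSup_of_mem n (Submodule.mem_iSup_of_mem π
    (Submodule.mem_iSup_of_mem hπ (Ideal.subset_span ?_)))
  refine ⟨s • (1 : Matrix (Fin n) (Fin n) R), fun j => ?_, by simp⟩
  have : (fun i => (s • (1 : Matrix (Fin n) (Fin n) R)) i j)
      = s • (fun i => (1 : Matrix (Fin n) (Fin n) R) i j) := rfl
  rw [this, map_smul]
  exact Module.mem_annihilator.1 hs _

/-- If `U ⊆ E` is generated by `ℓ` elements, `E_p = U_p` in codimension
`≤ ℓ - e + 1`, and the Eagon–Northcott bound `ht F₀(E/U) ≤ ℓ - e + 1` would hold whenever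
`F₀(E/U) ≠ R`, then `E = U`. -/
theorem statement_8 (R : Type u) [CommRing R] [IsLocalRing R] [IsNoetherianRing R]
    (E : Type u) [AddCommGroup E] [Module R E] [Module.Finite R E]
    (U : Submodule R E) (e ℓ : ℕ) (he : 0 < e) (hrank : HasRank R E e)
    (hU : ∃ f : Fin ℓ → E, Submodule.span R (Set.range f) = U)
    (hloc : ∀ (p : Ideal R) (hp : p.IsPrime),
      localDimAt R p hp ≤ ((ℓ - e + 1 : ℕ) : WithBot ℕ∞) →
      Subsingleton (LocalizedModule (primeCompl' R p hp) (E ⧸ U)))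
    (hEN : fitting0 R (E ⧸ U) ≠ ⊤ →
      idealHeight R (fitting0 R (E ⧸ U)) ≤ ((ℓ - e + 1 : ℕ) : WithBot ℕ∞)) :
    U = ⊤ := by
  by_cases hF : fitting0 R (E ⧸ U) = ⊤
  · have h := fitting0_le_annihilator R (E ⧸ U)
    rw [hF, top_le_iff, Module.annihilator_eq_top_iff] at h
    exact Submodule.Quotient.subsingleton_iff.1 h
  · exfalso
    have hle := hEN hF
    have hne : {d | ∃ (p : Ideal R) (hp : p.IsPrime), fitting0 R (E ⧸ U) ≤ p ∧
        d = localDimAt R p hp}.Nonempty :=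
      ⟨_, IsLocalRing.maximalIdeal R, inferInstance, IsLocalRing.le_maximalIdeal hF, rfl⟩
    obtain ⟨p, hp, hIp, hd⟩ := csInf_mem hne
    have hsub := hloc p hp (by rw [← hd]; exact hle)
    have hns : (⟨p, hp⟩ : PrimeSpectrum R) ∉ Module.support R (E ⧸ U) :=
      Module.notMem_support_iff.2 hsub
    rw [Module.mem_support_iff_of_finite] at hns
    obtain ⟨s, hs, hsp⟩ := SetLike.not_le_iff_exists.1 hns
    obtain ⟨n, hn⟩ := pow_mem_fitting0 R (E ⧸ U) s hs
    exact hsp (hp.mem_of_pow_mem n (hIp hn))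
end
end

section
/- Let S be a Noetherian local ring and let C• : 0 → C_j → C_{j−1} → ⋯ → C_0 → M → 0 be a complex of finitely generated S-modules with depth C_i ≥ i + 1 for all 0 ≤ i ≤ j, such that every nonzero homology module of the complex (in positions 0 through j) has depth 0, and the augmented homology H_{−1} vanishes. Then the complex is exact. -/
open scoped TensorProduct

noncomputable section

universe u

open CategoryTheory CategoryTheory.Abelian in
/-- Vanishing of `Ext^m(k, M)` for `m < n`. -/
def AcycV (R : Type u) [CommRing R] [IsLocalRing R] (n : ℕ) (M : ModuleCat.{u} R) : Prop :=
  ∀ m < n, Subsingleton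
    (Ext (ModuleCat.of R (R ⧸ IsLocalRing.maximalIdeal R)) M m)

section Acyc
open CategoryTheory CategoryTheory.Abelian RingTheory.Sequence

variable {R : Type u} [CommRing R] [IsLocalRing R]

lemma acycV_mid {S : ShortComplex (ModuleCat.{u} R)} (hS : S.ShortExact) {n : ℕ}
    (h1 : AcycV R n S.X₁) (h3 : AcycV R n S.X₃) : AcycV R n S.X₂ := by
  intro m hm
  have := h1 m hm
  have := h3 m hm
  refine subsingleton_of_forall_eq 0 fun x => ?_
  obtain ⟨y, rfl⟩ := Ext.covariant_sequence_exact₂ _ hS x (Subsingleton.elim _ _)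
  rw [Subsingleton.elim y 0, Ext.zero_comp]

lemma acycV_right {S : ShortComplex (ModuleCat.{u} R)} (hS : S.ShortExact) {n : ℕ}
    (h1 : AcycV R (n + 1) S.X₁) (h2 : AcycV R n S.X₂) : AcycV R n S.X₃ := by
  intro m hm
  have := h1 (m + 1) (by omega)
  have := h2 m hm
  refine subsingleton_of_forall_eq 0 fun x => ?_
  obtain ⟨y, rfl⟩ := Ext.covariant_sequence_exact₃ _ hS x rfl (Subsingleton.elim _ _)
  rw [Subsingleton.elim y 0, Ext.zero_comp]

lemma acycV_zero_left {M N : ModuleCat.{u} R} (f : M ⟶ N) [Mono f] (h : AcycV R 1 N) :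
    AcycV R 1 M := by
  intro m hm
  obtain rfl : m = 0 := by omega
  have := h 0 hm
  exact (Ext.postcomp_mk₀_injective_of_mono _ f).subsingleton

lemma acycV_of_subsingleton {M : ModuleCat.{u} R} [Subsingleton M] (n : ℕ) : AcycV R n M := by
  intro m _
  refine subsingleton_of_forall_eq 0 fun x => ?_
  have h : (𝟙 M) = 0 := (ModuleCat.isZero_of_subsingleton M).eq_of_src _ _
  rw [← Ext.comp_mk₀_id x, h, Ext.mk₀_zero, Ext.comp_zero]

lemma acyc_smul_lt (M : Type u) [AddCommGroup M] [Module R M] [Module.Finite R M]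
    [Nontrivial M] : IsLocalRing.maximalIdeal R • (⊤ : Submodule R M) < ⊤ := by
  refine lt_top_iff_ne_top.mpr fun h => ?_
  have := Submodule.eq_bot_of_le_smul_of_le_jacobson_bot (IsLocalRing.maximalIdeal R)
    (⊤ : Submodule R M) Module.Finite.fg_top h.ge
    (IsLocalRing.maximalIdeal_le_jacobson _)
  exact bot_ne_top this.symm

lemma acyc_supp : Module.support R (ModuleCat.of R (R ⧸ IsLocalRing.maximalIdeal R)) =
    PrimeSpectrum.zeroLocus (IsLocalRing.maximalIdeal R) := by
  change Module.support R (R ⧸ IsLocalRing.maximalIdeal R) = _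
  rw [Module.support_eq_zeroLocus, Ideal.annihilator_quotient]

lemma acycV_of_depth [IsNoetherianRing R] (M : ModuleCat.{u} R) [Module.Finite R M] (n : ℕ)
    (h : (n : ℕ∞) + 1 ≤ moduleDepth R (M : Type u)) : AcycV R (n + 1) M := by
  have h' : (n : ℕ∞) < moduleDepth R (M : Type u) :=
    (ENat.add_one_le_iff (ENat.coe_ne_top n)).mp h
  obtain ⟨_, ⟨rs, rfl, hmem, hreg⟩, hlt⟩ := lt_sSup_iff.mp h'
  have hlt' : n < rs.length := by exact_mod_cast hlt
  have : Nontrivial M := hreg.nontrivial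
  intro m hm
  have : Module.Finite R (ModuleCat.of R (R ⧸ IsLocalRing.maximalIdeal R)) :=
    inferInstanceAs (Module.Finite R (R ⧸ IsLocalRing.maximalIdeal R))
  exact ModuleCat.subsingleton_ext_of_exists_isRegular (IsLocalRing.maximalIdeal R) _
    acyc_supp.subset M (acyc_smul_lt M) rs hmem hreg m (by omega)

lemma acyc_subsingleton [IsNoetherianRing R] (M : ModuleCat.{u} R) [Module.Finite R M]
    (h : Subsingleton M ∨ moduleDepth R (M : Type u) = 0) (hV : AcycV R 1 M) :
    Subsingleton M := by
  rcases h with h | h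
  · exact h
  by_contra hn
  have : Nontrivial M := not_subsingleton_iff_nontrivial.mp hn
  have : Module.Finite R (ModuleCat.of R (R ⧸ IsLocalRing.maximalIdeal R)) :=
    inferInstanceAs (Module.Finite R (R ⧸ IsLocalRing.maximalIdeal R))
  obtain ⟨rs, hl, hmem, hreg⟩ := ModuleCat.exists_isRegular_of_exists_subsingleton_ext
    (IsLocalRing.maximalIdeal R) 1 M (acyc_smul_lt M)
    (ModuleCat.of R (R ⧸ IsLocalRing.maximalIdeal R)) acyc_supp hV
  have h1 : (1 : ℕ∞) ≤ moduleDepth R (M : Type u) :=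
    le_sSup ⟨rs, by simp [hl], hmem, hreg⟩
  rw [h] at h1
  simp at h1

lemma acyc_depth_congr {M N : Type u} [AddCommGroup M] [Module R M] [AddCommGroup N]
    [Module R N] (e : M ≃ₗ[R] N) : moduleDepth R M = moduleDepth R N := by
  unfold moduleDepth sequenceGrade
  simp only [e.isRegular_congr]

/-- `0 → N → M → M/N → 0`. -/
lemma acyc_ses {M : Type u} [AddCommGroup M] [Module R M] (N : Submodule R M) :
    (ShortComplex.mk (ModuleCat.ofHom N.subtype) (ModuleCat.ofHom N.mkQ)
      (by ext x; simp)).ShortExact := by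
  refine ShortComplex.ShortExact.mk' ?_ ?_ ?_
  · rw [ShortComplex.moduleCat_exact_iff_range_eq_ker]
    simp
  · exact (ModuleCat.mono_iff_injective _).mpr N.subtype_injective
  · exact (ModuleCat.epi_iff_surjective _).mpr N.mkQ_surjective

/-- `0 → ker f → M → range f → 0`. -/
lemma acyc_ses' {M P : Type u} [AddCommGroup M] [Module R M] [AddCommGroup P] [Module R P]
    (f : M →ₗ[R] P) (K : Submodule R M) (hK : LinearMap.ker f = K) :
    (ShortComplex.mk (ModuleCat.ofHom K.subtype) (ModuleCat.ofHom f.rangeRestrict)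
      (by subst hK; ext x; simp)).ShortExact := by
  subst hK
  refine ShortComplex.ShortExact.mk' ?_ ?_ ?_
  · rw [ShortComplex.moduleCat_exact_iff_range_eq_ker]
    simp
  · exact (ModuleCat.mono_iff_injective _).mpr (Submodule.subtype_injective _)
  · exact (ModuleCat.epi_iff_surjective _).mpr f.surjective_rangeRestrict

/-- One step: given vanishing for boundaries, the homology vanishes and cycles inherit it. -/
lemma acyc_step [IsNoetherianRing R] (S : ShortComplex (ModuleCat.{u} R))
    [Module.Finite R S.X₂] (n : ℕ)
    (hB : AcycV R (n + 2) (ModuleCat.of R (LinearMap.range S.moduleCatToCycles)))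
    (hC : AcycV R 1 S.X₂)
    (hH : Subsingleton S.homology ∨ moduleDepth R (S.homology : Type u) = 0) :
    S.Exact ∧ AcycV R (n + 2) (ModuleCat.of R (LinearMap.ker S.g.hom)) := by
  have hZ : AcycV R 1 (ModuleCat.of R (LinearMap.ker S.g.hom)) := by
    have : Mono (ModuleCat.ofHom (LinearMap.ker S.g.hom).subtype) :=
      (ModuleCat.mono_iff_injective _).mpr (Submodule.subtype_injective _)
    exact acycV_zero_left (ModuleCat.ofHom (LinearMap.ker S.g.hom).subtype) hC
  have hses := acyc_ses (LinearMap.range S.moduleCatToCycles)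
  let e : S.homology ≃ₗ[R] (LinearMap.ker S.g.hom ⧸ LinearMap.range S.moduleCatToCycles) :=
    S.moduleCatHomologyIso.toLinearEquiv
  have hQV : AcycV R 1 (ModuleCat.of R
      (LinearMap.ker S.g.hom ⧸ LinearMap.range S.moduleCatToCycles)) :=
    acycV_right hses (fun m hm => hB m (by omega)) hZ
  have hQ : Subsingleton (ModuleCat.of R
      (LinearMap.ker S.g.hom ⧸ LinearMap.range S.moduleCatToCycles)) := by
    refine @acyc_subsingleton R _ _ _ _ ?_ ?_ hQV
    · exact inferInstanceAs (Module.Finite R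
        (LinearMap.ker S.g.hom ⧸ LinearMap.range S.moduleCatToCycles))
    · rcases hH with hH | hH
      · exact Or.inl e.symm.toEquiv.subsingleton
      · exact Or.inr ((acyc_depth_congr e).symm.trans hH)
  refine ⟨?_, acycV_mid hses hB (acycV_of_subsingleton _)⟩
  rw [ShortComplex.exact_iff_isZero_homology]
  have : Subsingleton S.homology := @Equiv.subsingleton _ _ e.toEquiv hQ
  exact ModuleCat.isZero_of_subsingleton _

end Acyc

/-- (Acyclicity Lemma application.) A complex
`0 → C_j → ⋯ → C_0 → M → 0` of finite modules over a Noetherian local ring with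
`depth C_i ≥ i + 1`, in which every nonzero homology in positions `0, …, j` has depth `0`
and the augmented homology `H_{-1}` vanishes, is exact. -/
theorem statement_14 (R : Type u) [CommRing R] [IsLocalRing R] [IsNoetherianRing R]
    (D : ChainComplex (ModuleCat.{u} R) ℕ)
    (hfin : ∀ i, Module.Finite R (D.X i))
    (j : ℕ)
    (hbd : ∀ i, j + 1 < i → Subsingleton (D.X i))
    (hdepth : ∀ i, i ≤ j → ((i : ℕ∞) + 1) ≤ moduleDepth R (D.X (i + 1) : Type u))
    (hhom : ∀ i, i ≤ j → Subsingleton (D.homology (i + 1)) ∨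
      moduleDepth R (D.homology (i + 1) : Type u) = 0)
    (haug : D.ExactAt 0) :
    ∀ i, D.ExactAt i := by
  classical
  let S : ℕ → CategoryTheory.ShortComplex (ModuleCat.{u} R) := fun q => D.sc' (q + 2) (q + 1) q
  have iso : ∀ q, D.homology (q + 1) ≅ (S q).homology := fun q =>
    D.homologyIsoSc' (q + 2) (q + 1) q (by simp) (by simp)
  have hfin' : ∀ q, Module.Finite R (S q).X₂ := fun q => hfin (q + 1)
  -- the step
  have step : ∀ q, q ≤ j →
      AcycV R (q + 2) (ModuleCat.of R (LinearMap.range (S q).moduleCatToCycles)) →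
      (S q).Exact ∧ AcycV R (q + 2) (ModuleCat.of R (LinearMap.ker (S q).g.hom)) := by
    intro q hq hB
    have := hfin (q + 1)
    refine acyc_step (S q) q hB ?_ ?_
    · intro m hm
      exact acycV_of_depth (D.X (q + 1)) q (hdepth q hq) m (by omega)
    · rcases hhom q hq with h | h
      · exact Or.inl (iso q).toLinearEquiv.symm.toEquiv.subsingleton
      · exact Or.inr ((acyc_depth_congr (iso q).toLinearEquiv).symm.trans h)
  have main : ∀ t q, q + t = j →
      AcycV R (q + 2) (ModuleCat.of R (LinearMap.range (S q).moduleCatToCycles)) := by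
    intro t
    induction t with
    | zero =>
      intro q hq
      have hs : Subsingleton (S q).X₁ := hbd (q + 2) (by omega)
      have : Subsingleton (ModuleCat.of R (LinearMap.range (S q).moduleCatToCycles)) :=
        (LinearMap.surjective_rangeRestrict (S q).moduleCatToCycles).subsingleton
      exact acycV_of_subsingleton _
    | succ t ih =>
      intro q hq
      obtain ⟨-, hZ⟩ := step (q + 1) (by omega) (ih (q + 1) (by omega))
      have := hfin (q + 2)
      have hC : AcycV R (q + 2) (D.X (q + 2)) := by
        have := hdepth (q + 1) (by omega)
        exact acycV_of_depth (D.X (q + 2)) (q + 1) this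
      exact acycV_right (acyc_ses' (S q).moduleCatToCycles (LinearMap.ker (S (q + 1)).g.hom)
        (LinearMap.ker_codRestrict _ _ _)) hZ hC
  intro i
  rcases i with _ | q
  · exact haug
  by_cases hq : q ≤ j
  · rw [D.exactAt_iff' (q + 2) (q + 1) q (by simp) (by simp)]
    exact (step q hq (main (j - q) q (by omega))).1
  · have := hbd (q + 1) (by omega)
    exact HomologicalComplex.ExactAt.of_isZero (ModuleCat.isZero_of_subsingleton _)
end
end
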